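/- Let f : ℝ⁴ → ℂ be a Schwartz function of unit frequency and u(t,x) = e^{it√(−Δ)}f(x). For 0 < μ ≤ 1 let {Q_α}_{α∈ℤ⁴} be the partition of ℝ⁴ into cubes of side length 1/μ. Then for every r ∈ [6,∞) there is a constant C_r, independent of f and μ, such that ( ∫_ℝ ( Σ_{α∈ℤ⁴} ‖u(t,·)‖_{L²(Q_α)}^r )^{2/r} dt )^{1/2} ≤ C_r μ^{−1} ‖f‖_{L²(ℝ⁴)}. -/

import Mathlib

open MeasureTheory Complex
open scoped FourierTransform RealInnerProductSpace ENNReal BigOperators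

noncomputable section

/-- Four-dimensional Euclidean space. -/
abbrev Sp : Type := EuclideanSpace ℝ (Fin 4)

/-- The half-wave propagator `e^{it√(−Δ)}f(x) = ∫ e^{2πi(t|ξ| + x·ξ)} f̂(ξ) dξ`. -/
def halfWave (f : Sp → ℂ) (t : ℝ) (x : Sp) : ℂ :=
  ∫ ξ : Sp, Complex.exp (2 * Real.pi * Complex.I * ((t * ‖ξ‖ + ⟪x, ξ⟫ : ℝ) : ℂ)) * 𝓕 f ξ

/-- `f` has unit frequency: `f̂` is supported in the annulus `{1/2 ≤ |ξ| ≤ 2}`. -/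
def UnitFrequency (f : Sp → ℂ) : Prop :=
  ∀ ξ : Sp, 𝓕 f ξ ≠ 0 → 1/2 ≤ ‖ξ‖ ∧ ‖ξ‖ ≤ 2

/-- The lattice cube `Q_α = {x : μx − α ∈ [0,1)⁴}` of side length `1/μ`. -/
def cube (μ : ℝ) (a : Fin 4 → ℤ) : Set Sp :=
  {x : Sp | ∀ i : Fin 4, (a i : ℝ) ≤ μ * x i ∧ μ * x i < a i + 1}

/-- The local `L²` norm `‖h‖_{L²(Q_α)}`. -/
def cubeNorm (μ : ℝ) (a : Fin 4 → ℤ) (h : Sp → ℂ) : ℝ≥0∞ :=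
  (∫⁻ x in cube μ a, (‖h x‖₊ : ℝ≥0∞) ^ (2:ℝ)) ^ (1/2 : ℝ)

/-- The dyadic (base `256`) scale of the distance between two integers. -/
def timeScale (n m : ℤ) : ℕ := Nat.log 256 (n - m).natAbs

lemma timeScale_comm (n m : ℤ) : timeScale n m = timeScale m n := by
  unfold timeScale
  rw [← Int.natAbs_neg, neg_sub]

lemma natAbs_sub_lt_of_timeScale_le {n m : ℤ} {j : ℕ} (h : timeScale n m ≤ j) :
    (n - m).natAbs < 256 ^ (j + 1) :=
  Nat.lt_pow_of_log_lt (by norm_num) (Nat.lt_succ_of_le h)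

lemma timeScale_le_of_natAbs_sub_lt {n m : ℤ} {j : ℕ} (h : (n - m).natAbs < 256 ^ (j + 1)) :
    timeScale n m ≤ j :=
  Nat.lt_succ_iff.mp (Nat.log_lt_of_lt_pow' (by omega) h)

lemma card_filter_timeScale_le (N : Finset ℤ) (n : ℤ) (j : ℕ) :
    ((N.filter fun m => timeScale n m = j).card : ℝ) ≤ 512 * 256 ^ j := by
  have hsub : (N.filter fun m => timeScale n m = j) ⊆
      Finset.Ico (n - 256 ^ (j + 1)) (n + 256 ^ (j + 1)) := by
    intro m hm
    have h := natAbs_sub_lt_of_timeScale_le (Finset.mem_filter.mp hm).2.le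
    have h' : ((n - m).natAbs : ℤ) < 256 ^ (j + 1) := by exact_mod_cast h
    rw [Finset.mem_Ico]
    generalize (256 : ℤ) ^ (j + 1) = R at *
    omega
  have h := Finset.card_le_card hsub
  rw [Int.card_Ico] at h
  have h2 : (((n + 256 ^ (j + 1)) - (n - 256 ^ (j + 1)) : ℤ).toNat) = 2 * 256 ^ (j + 1) := by
    have : ((n + 256 ^ (j + 1)) - (n - 256 ^ (j + 1)) : ℤ) = ((2 * 256 ^ (j + 1) : ℕ) : ℤ) := by
      push_cast; ring
    rw [this, Int.toNat_natCast]
  rw [h2] at h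
  calc ((N.filter fun m => timeScale n m = j).card : ℝ) ≤ ((2 * 256 ^ (j + 1) : ℕ) : ℝ) := by
        exact_mod_cast h
    _ = 512 * 256 ^ j := by push_cast; ring

lemma le_of_sq_le_sq' {a b : ℝ} (h : a ^ 2 ≤ b ^ 2) (hb : 0 ≤ b) : a ≤ b :=
  (abs_le_of_sq_le_sq' h hb).2

/-- Schur's test for finite matrices. -/
lemma sq_sum_kernel_le {ι κ : Type*} (N : Finset ι) (N' : Finset κ) (k : ι → κ → ℝ)
    (hk : ∀ n m, 0 ≤ k n m) {M : ℝ}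
    (h1 : ∀ n ∈ N, ∑ m ∈ N', k n m ≤ M) (h2 : ∀ m ∈ N', ∑ n ∈ N, k n m ≤ M)
    (hM : 0 ≤ M) (X : ι → ℝ) (Y : κ → ℝ) :
    (∑ n ∈ N, ∑ m ∈ N', k n m * (X n * Y m)) ^ 2 ≤
      M ^ 2 * (∑ n ∈ N, X n ^ 2) * ∑ m ∈ N', Y m ^ 2 := by
  have h := Finset.sum_sq_le_sum_mul_sum_of_sq_le_mul (N ×ˢ N')
    (r := fun p => k p.1 p.2 * (X p.1 * Y p.2))
    (f := fun p => k p.1 p.2 * X p.1 ^ 2) (g := fun p => k p.1 p.2 * Y p.2 ^ 2)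
    (fun p _ => mul_nonneg (hk _ _) (sq_nonneg _)) (fun p _ => mul_nonneg (hk _ _) (sq_nonneg _))
    (fun p _ => le_of_eq (by ring))
  have e1 : ∑ p ∈ N ×ˢ N', k p.1 p.2 * X p.1 ^ 2 ≤ M * ∑ n ∈ N, X n ^ 2 := by
    rw [Finset.sum_product, Finset.mul_sum]
    refine Finset.sum_le_sum fun n hn => ?_
    simp only [← Finset.sum_mul]
    exact mul_le_mul_of_nonneg_right (h1 n hn) (sq_nonneg _)
  have e2 : ∑ p ∈ N ×ˢ N', k p.1 p.2 * Y p.2 ^ 2 ≤ M * ∑ m ∈ N', Y m ^ 2 := by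
    rw [Finset.sum_product_right, Finset.mul_sum]
    refine Finset.sum_le_sum fun m hm => ?_
    simp only [← Finset.sum_mul]
    exact mul_le_mul_of_nonneg_right (h2 m hm) (sq_nonneg _)
  rw [Finset.sum_product] at h
  refine h.trans ((mul_le_mul e1 e2 ?_ ?_).trans (le_of_eq (by ring)))
  · exact Finset.sum_nonneg fun p _ => mul_nonneg (hk _ _) (sq_nonneg _)
  · exact mul_nonneg hM (Finset.sum_nonneg fun _ _ => sq_nonneg _)

section KeelTao

variable {H : Type*} [NormedAddCommGroup H] [InnerProductSpace ℝ H]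

/-- The part of the bilinear form living at a fixed time scale. -/
def scalePart (N : Finset ℤ) (φ : ℤ → ℕ → H) (j k l : ℕ) : ℝ :=
  ∑ n ∈ N, ∑ m ∈ N, if timeScale n m = j then ⟪φ n k, φ m l⟫ else 0

lemma scalePart_comm (N : Finset ℤ) (φ : ℤ → ℕ → H) (j k l : ℕ) :
    scalePart N φ j k l = scalePart N φ j l k := by
  unfold scalePart
  rw [Finset.sum_comm]
  refine Finset.sum_congr rfl fun m _ => Finset.sum_congr rfl fun n _ => ?_
  rw [timeScale_comm, real_inner_comm]

lemma sum_ite_timeScale_le (N : Finset ℤ) (n : ℤ) (j : ℕ) {c : ℝ} (hc : 0 ≤ c) :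
    ∑ m ∈ N, (if timeScale n m = j then c else 0) ≤ 512 * 256 ^ j * c := by
  rw [← Finset.sum_filter, Finset.sum_const, nsmul_eq_mul]
  exact mul_le_mul_of_nonneg_right (card_filter_timeScale_le N n j) hc

variable {N : Finset ℤ} {φ : ℤ → ℕ → H} {X : ℤ → ℕ → ℝ}

lemma scalePart_sq_le_of_decay 
    (hb : ∀ n m k l, |⟪φ n k, φ m l⟫| ≤
      (1 / 4096) ^ timeScale n m * (X n k * X m l) * 4 ^ (k + l)) (j k l : ℕ) :
    scalePart N φ j k l ^ 2 ≤ 2 ^ 18 * ((1 / 256) ^ j * 16 ^ (k + l)) *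
      ((∑ n ∈ N, X n k ^ 2) * ∑ n ∈ N, X n l ^ 2) := by
  set c : ℝ := (1 / 4096) ^ j * 4 ^ (k + l) with hc
  have hc0 : 0 ≤ c := by positivity
  have h1 : |scalePart N φ j k l| ≤
      ∑ n ∈ N, ∑ m ∈ N, (if timeScale n m = j then c else 0) * (X n k * X m l) := by
    refine (Finset.abs_sum_le_sum_abs _ _).trans (Finset.sum_le_sum fun n _ => ?_)
    refine (Finset.abs_sum_le_sum_abs _ _).trans (Finset.sum_le_sum fun m _ => ?_)
    split_ifs with h
    · refine (hb n m k l).trans (le_of_eq ?_)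
      rw [h, hc]; ring
    · simp
  have h2 := sq_sum_kernel_le N N (fun n m => if timeScale n m = j then c else 0)
    (fun n m => by split_ifs <;> simp [hc0]) (M := 512 * 256 ^ j * c)
    (fun n _ => sum_ite_timeScale_le N n j hc0)
    (fun m _ => by
      simp_rw [timeScale_comm _ m]; exact sum_ite_timeScale_le N m j hc0)
    (by positivity) (fun n => X n k) (fun n => X n l)
  calc scalePart N φ j k l ^ 2 = |scalePart N φ j k l| ^ 2 := (sq_abs _).symm
    _ ≤ _ := pow_le_pow_left₀ (abs_nonneg _) h1 2
    _ ≤ _ := h2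
    _ = (512 * 256 ^ j * c) ^ 2 * ((∑ n ∈ N, X n k ^ 2) * ∑ n ∈ N, X n l ^ 2) := by ring
    _ = _ := by
      congr 1
      rw [hc]
      have e1 : ((256 : ℝ) ^ j * (1 / 4096) ^ j) ^ 2 = (1 / 256) ^ j := by
        rw [← mul_pow, ← pow_mul, mul_comm j 2, pow_mul]; norm_num
      have e2 : ((4 : ℝ) ^ (k + l)) ^ 2 = 16 ^ (k + l) := by
        rw [← pow_mul, mul_comm _ 2, pow_mul]; norm_num
      rw [← e1, ← e2]; ring

lemma abs_inner_le_geom_mean (hX : ∀ n k, 0 ≤ X n k)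
    (ha : ∀ n k, ‖φ n k‖ ≤ X n k * (1 / 16) ^ k)
    (hb : ∀ n m k l, |⟪φ n k, φ m l⟫| ≤
      (1 / 4096) ^ timeScale n m * (X n k * X m l) * 4 ^ (k + l)) (n m : ℤ) (k : ℕ) :
    |⟪φ n k, φ m k⟫| ≤ (1 / 64) ^ timeScale n m * (1 / 4) ^ k * (X n k * X m k) := by
  have h1 : |⟪φ n k, φ m k⟫| ≤ (X n k * X m k) * (1 / 256) ^ k := by
    refine (abs_real_inner_le_norm _ _).trans ((mul_le_mul (ha n k) (ha m k) (norm_nonneg _)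
      (mul_nonneg (hX _ _) (by positivity))).trans (le_of_eq ?_))
    rw [show (1 / 256 : ℝ) = (1 / 16) * (1 / 16) by norm_num, mul_pow]; ring
  have h2 := hb n m k k
  have hXX : 0 ≤ X n k * X m k := mul_nonneg (hX _ _) (hX _ _)
  refine le_of_sq_le_sq' ?_ (by positivity)
  calc |⟪φ n k, φ m k⟫| ^ 2 = |⟪φ n k, φ m k⟫| * |⟪φ n k, φ m k⟫| := sq _
    _ ≤ _ := mul_le_mul h1 h2 (abs_nonneg _) (by positivity)
    _ = _ := by
      have e1 : ((1 / 64 : ℝ) ^ timeScale n m) ^ 2 = (1 / 4096) ^ timeScale n m := by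
        rw [← pow_mul, mul_comm _ 2, pow_mul]; norm_num
      have e2 : (1 / 256 : ℝ) ^ k * 4 ^ (k + k) = ((1 / 4) ^ k) ^ 2 := by
        rw [← two_mul, pow_mul, ← mul_pow, ← pow_mul, mul_comm k 2, pow_mul]; norm_num
      rw [mul_pow, mul_pow, e1, ← e2]; ring

lemma sum_truncated_kernel_le (N : Finset ℤ) (n : ℤ) (j : ℕ) :
    ∑ m ∈ N, (if timeScale n m ≤ j then (1 / 64 : ℝ) ^ timeScale n m else 0) ≤
      2048 * 4 ^ j := by
  have h : ∀ m : ℤ, (if timeScale n m ≤ j then (1 / 64 : ℝ) ^ timeScale n m else 0) =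
      ∑ s ∈ Finset.range (j + 1), if timeScale n m = s then (1 / 64 : ℝ) ^ s else 0 := by
    intro m
    rw [Finset.sum_ite_eq]
    simp
  simp_rw [h]
  rw [Finset.sum_comm]
  have h2 : ∀ j : ℕ, ∑ s ∈ Finset.range (j + 1), (4 : ℝ) ^ s ≤ 4 * 4 ^ j := by
    intro j
    induction j with
    | zero => norm_num
    | succ j ih => rw [Finset.sum_range_succ, pow_succ]; nlinarith [pow_pos (four_pos (α := ℝ)) j]
  calc _ ≤ ∑ s ∈ Finset.range (j + 1), (512 : ℝ) * 4 ^ s := by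
        refine Finset.sum_le_sum fun s _ => ?_
        refine (sum_ite_timeScale_le N n s (by positivity)).trans (le_of_eq ?_)
        rw [mul_assoc, ← mul_pow]; norm_num
    _ ≤ _ := by rw [← Finset.mul_sum]; linarith [h2 j]

lemma sum_pair_timeScale_le (N : Finset ℤ) (n n' : ℤ) (j : ℕ) :
    ∑ m ∈ N, (if timeScale n m = j ∧ timeScale n' m = j then (1 : ℝ) else 0) ≤
      512 * 256 ^ j * if timeScale n n' ≤ j + 1 then 1 else 0 := by
  split_ifs with h
  · have h1 := sum_ite_timeScale_le N n j zero_le_one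
    refine le_trans (Finset.sum_le_sum fun m _ => ?_) h1
    split_ifs <;> first | exact le_rfl | exact zero_le_one | (exfalso; tauto)
  · rw [mul_zero]
    refine (Finset.sum_eq_zero fun m _ => ?_).le
    rw [if_neg]
    rintro ⟨h1, h2⟩
    apply h
    have h1' := natAbs_sub_lt_of_timeScale_le h1.le
    have h2' := natAbs_sub_lt_of_timeScale_le h2.le
    refine timeScale_le_of_natAbs_sub_lt ?_
    rw [pow_succ 256 (j + 1)]
    generalize 256 ^ (j + 1) = R at *
    omega

lemma scalePart_sq_le_of_local (hX : ∀ n k, 0 ≤ X n k)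
    (ha : ∀ n k, ‖φ n k‖ ≤ X n k * (1 / 16) ^ k)
    (hb : ∀ n m k l, |⟪φ n k, φ m l⟫| ≤
      (1 / 4096) ^ timeScale n m * (X n k * X m l) * 4 ^ (k + l)) (j k l : ℕ) :
    scalePart N φ j k l ^ 2 ≤ 2 ^ 22 * (1024 ^ j * (1 / 4) ^ k * (1 / 256) ^ l) *
      ((∑ n ∈ N, X n k ^ 2) * ∑ n ∈ N, X n l ^ 2) := by
  set Φ : ℤ → H := fun m => ∑ n ∈ N, if timeScale n m = j then φ n k else 0 with hΦ
  have hT : scalePart N φ j k l = ∑ m ∈ N, ⟪Φ m, φ m l⟫ := by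
    unfold scalePart
    rw [Finset.sum_comm]
    refine Finset.sum_congr rfl fun m _ => ?_
    rw [hΦ, sum_inner]
    refine Finset.sum_congr rfl fun n _ => ?_
    split_ifs <;> simp
  have hΦ2 : ∑ m ∈ N, ‖Φ m‖ ^ 2 ≤ 2 ^ 22 * (1024 ^ j * (1 / 4) ^ k) * ∑ n ∈ N, X n k ^ 2 := by
    have h1 : ∀ m, ‖Φ m‖ ^ 2 ≤ ∑ n ∈ N, ∑ n' ∈ N,
        (if timeScale n m = j ∧ timeScale n' m = j then (1 : ℝ) else 0) *
          ((1 / 64) ^ timeScale n n' * (1 / 4) ^ k * (X n k * X n' k)) := by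
      intro m
      rw [← real_inner_self_eq_norm_sq, hΦ, sum_inner]
      refine Finset.sum_le_sum fun n _ => ?_
      rw [inner_sum]
      refine Finset.sum_le_sum fun n' _ => ?_
      by_cases h : timeScale n m = j <;> by_cases h' : timeScale n' m = j <;> simp only [h, h'] <;>
        simp
      have := (le_abs_self _).trans (abs_inner_le_geom_mean hX ha hb n n' k)
      simpa using this
    set κ : ℤ → ℤ → ℝ := fun n n' =>
      if timeScale n n' ≤ j + 1 then (1 / 64 : ℝ) ^ timeScale n n' else 0 with hκ
    have hS := sq_sum_kernel_le N N κ (fun n m => by rw [hκ]; dsimp only; split_ifs <;> positivity)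
      (M := 2048 * 4 ^ (j + 1)) (fun n _ => sum_truncated_kernel_le N n (j + 1))
      (fun m _ => by
        simp_rw [hκ, timeScale_comm _ m]; exact sum_truncated_kernel_le N m (j + 1))
      (by positivity) (fun n => X n k) (fun n => X n k)
    have hS' : ∑ n ∈ N, ∑ m ∈ N, κ n m * (X n k * X m k) ≤
        2048 * 4 ^ (j + 1) * ∑ n ∈ N, X n k ^ 2 := by
      refine le_of_sq_le_sq' (hS.trans (le_of_eq (by ring))) ?_
      exact mul_nonneg (by positivity) (Finset.sum_nonneg fun _ _ => sq_nonneg _)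
    calc ∑ m ∈ N, ‖Φ m‖ ^ 2 ≤ _ := Finset.sum_le_sum fun m _ => h1 m
      _ = ∑ n ∈ N, ∑ n' ∈ N, (∑ m ∈ N,
          (if timeScale n m = j ∧ timeScale n' m = j then (1 : ℝ) else 0)) *
          ((1 / 64) ^ timeScale n n' * (1 / 4) ^ k * (X n k * X n' k)) := by
        rw [Finset.sum_comm]
        refine Finset.sum_congr rfl fun n _ => ?_
        rw [Finset.sum_comm]
        exact Finset.sum_congr rfl fun n' _ => (Finset.sum_mul _ _ _).symm
      _ ≤ ∑ n ∈ N, ∑ n' ∈ N, (512 * 256 ^ j * (1 / 4) ^ k) * (κ n n' * (X n k * X n' k)) := by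
        refine Finset.sum_le_sum fun n _ => Finset.sum_le_sum fun n' _ => ?_
        have hXX : 0 ≤ X n k * X n' k := mul_nonneg (hX _ _) (hX _ _)
        refine (mul_le_mul_of_nonneg_right (sum_pair_timeScale_le N n n' j)
          (by positivity)).trans (le_of_eq ?_)
        rw [hκ]; dsimp only
        split_ifs <;> ring
      _ = (512 * 256 ^ j * (1 / 4) ^ k) * ∑ n ∈ N, ∑ n' ∈ N, κ n n' * (X n k * X n' k) := by
        simp_rw [Finset.mul_sum]
      _ ≤ _ := mul_le_mul_of_nonneg_left hS' (by positivity)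
      _ = _ := by
        rw [show (1024 : ℝ) = 256 * 4 by norm_num, mul_pow]; ring
  calc scalePart N φ j k l ^ 2 ≤ (∑ m ∈ N, ‖Φ m‖ * (X m l * (1 / 16) ^ l)) ^ 2 := by
        rw [hT, ← sq_abs]
        refine pow_le_pow_left₀ (abs_nonneg _) ?_ 2
        refine (Finset.abs_sum_le_sum_abs _ _).trans (Finset.sum_le_sum fun m _ => ?_)
        exact (abs_real_inner_le_norm _ _).trans
          (mul_le_mul_of_nonneg_left (ha m l) (norm_nonneg _))
    _ ≤ (∑ m ∈ N, ‖Φ m‖ ^ 2) * ∑ m ∈ N, (X m l * (1 / 16) ^ l) ^ 2 :=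
        Finset.sum_mul_sq_le_sq_mul_sq _ _ _
    _ ≤ (2 ^ 22 * (1024 ^ j * (1 / 4) ^ k) * ∑ n ∈ N, X n k ^ 2) *
          ∑ m ∈ N, (X m l * (1 / 16) ^ l) ^ 2 :=
        mul_le_mul_of_nonneg_right hΦ2 (Finset.sum_nonneg fun _ _ => sq_nonneg _)
    _ = _ := by
        simp_rw [mul_pow, ← pow_mul, mul_comm l 2, pow_mul, ← Finset.sum_mul]
        rw [show (1 / 16 : ℝ) ^ 2 = 1 / 256 by norm_num]; ring

lemma min_scale_le (j k l : ℕ) :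
    (1 / 256 : ℝ) ^ j * 16 ^ (k + l) ≤
        (1 / 2) ^ ((j : ℤ) - k).natAbs * (1 / 2) ^ ((j : ℤ) - l).natAbs ∨
    (1024 : ℝ) ^ j * (1 / 4) ^ k * (1 / 256) ^ l ≤
        (1 / 2) ^ ((j : ℤ) - k).natAbs * (1 / 2) ^ ((j : ℤ) - l).natAbs ∨
    (1024 : ℝ) ^ j * (1 / 4) ^ l * (1 / 256) ^ k ≤
        (1 / 2) ^ ((j : ℤ) - k).natAbs * (1 / 2) ^ ((j : ℤ) - l).natAbs := by
  have e1 : (1 / 256 : ℝ) ^ j * 16 ^ (k + l) = (2 : ℝ) ^ (-(8 * j) + 4 * (k + l) : ℤ) := by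
    rw [zpow_add₀ two_ne_zero, zpow_neg]
    norm_cast
    rw [pow_mul, pow_mul, one_div_pow]; norm_num
  have e2 : ∀ k l : ℕ, (1024 : ℝ) ^ j * (1 / 4) ^ k * (1 / 256) ^ l =
      (2 : ℝ) ^ (10 * j + -(2 * k) + -(8 * l) : ℤ) := by
    intro k l
    rw [zpow_add₀ two_ne_zero, zpow_add₀ two_ne_zero, zpow_neg, zpow_neg]
    norm_cast
    rw [pow_mul, pow_mul, pow_mul, one_div_pow, one_div_pow]; norm_num
  have e3 : (1 / 2 : ℝ) ^ ((j : ℤ) - k).natAbs * (1 / 2) ^ ((j : ℤ) - l).natAbs =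
      (2 : ℝ) ^ (-(((j : ℤ) - k).natAbs : ℤ) + -(((j : ℤ) - l).natAbs : ℤ)) := by
    rw [zpow_add₀ two_ne_zero, zpow_neg, zpow_neg, zpow_natCast, zpow_natCast]; simp
  rw [e1, e2, e2, e3, zpow_le_zpow_iff_right₀ one_lt_two, zpow_le_zpow_iff_right₀ one_lt_two,
    zpow_le_zpow_iff_right₀ one_lt_two]
  omega

lemma abs_scalePart_le (hX : ∀ n k, 0 ≤ X n k)
    (ha : ∀ n k, ‖φ n k‖ ≤ X n k * (1 / 16) ^ k)
    (hb : ∀ n m k l, |⟪φ n k, φ m l⟫| ≤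
      (1 / 4096) ^ timeScale n m * (X n k * X m l) * 4 ^ (k + l)) (j k l : ℕ) :
    |scalePart N φ j k l| ≤ 2 ^ 11 *
      (((3 / 4) ^ ((j : ℤ) - k).natAbs * √(∑ n ∈ N, X n k ^ 2)) *
        ((3 / 4) ^ ((j : ℤ) - l).natAbs * √(∑ n ∈ N, X n l ^ 2))) := by
  have hx : ∀ k, 0 ≤ ∑ n ∈ N, X n k ^ 2 := fun k => Finset.sum_nonneg fun _ _ => sq_nonneg _
  set P := ((j : ℤ) - k).natAbs
  set Q := ((j : ℤ) - l).natAbs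
  have key : scalePart N φ j k l ^ 2 ≤ 2 ^ 22 * ((1 / 2) ^ P * (1 / 2) ^ Q) *
      ((∑ n ∈ N, X n k ^ 2) * ∑ n ∈ N, X n l ^ 2) := by
    have hxx := mul_nonneg (hx k) (hx l)
    rcases min_scale_le j k l with h | h | h
    · refine (scalePart_sq_le_of_decay hb j k l).trans ?_
      refine mul_le_mul_of_nonneg_right (mul_le_mul (by norm_num) h (by positivity)
        (by norm_num)) hxx
    · refine (scalePart_sq_le_of_local hX ha hb j k l).trans ?_
      exact mul_le_mul_of_nonneg_right (mul_le_mul_of_nonneg_left h (by norm_num)) hxx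
    · rw [scalePart_comm]
      refine (scalePart_sq_le_of_local hX ha hb j l k).trans ?_
      rw [mul_comm (∑ n ∈ N, X n l ^ 2)]
      exact mul_le_mul_of_nonneg_right (mul_le_mul_of_nonneg_left h (by norm_num)) hxx
  refine le_of_sq_le_sq' ?_ (by positivity)
  rw [sq_abs]
  refine key.trans ?_
  have hq : ∀ P : ℕ, (1 / 2 : ℝ) ^ P ≤ ((3 / 4) ^ P) ^ 2 := by
    intro P
    rw [← pow_mul, mul_comm P 2, pow_mul]
    exact pow_le_pow_left₀ (by norm_num) (by norm_num) _
  calc _ ≤ 2 ^ 22 * (((3 / 4) ^ P) ^ 2 * ((3 / 4) ^ Q) ^ 2) *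
      ((∑ n ∈ N, X n k ^ 2) * ∑ n ∈ N, X n l ^ 2) := by
        have := hx k; have := hx l; have := hq P; have := hq Q
        gcongr
    _ = _ := by
      rw [mul_pow, mul_pow, mul_pow, mul_pow, Real.sq_sqrt (hx k), Real.sq_sqrt (hx l)]
      ring

lemma sum_geom_dist_le (K : Finset ℕ) (j : ℕ) :
    ∑ k ∈ K, (3 / 4 : ℝ) ^ ((j : ℤ) - k).natAbs ≤ 8 := by
  have hgeom : ∀ s : Finset ℕ, ∑ d ∈ s, (3 / 4 : ℝ) ^ d ≤ 4 := by
    intro s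
    have h := (summable_geometric_of_lt_one (r := (3 / 4 : ℝ)) (by norm_num)
      (by norm_num)).sum_le_tsum s (fun _ _ => by positivity)
    rw [tsum_geometric_of_lt_one (by norm_num) (by norm_num)] at h
    norm_num at h ⊢
    exact h
  rw [← Finset.sum_filter_add_sum_filter_not K (fun k => k ≤ j)]
  have h1 : ∑ k ∈ K with k ≤ j, (3 / 4 : ℝ) ^ ((j : ℤ) - k).natAbs ≤ 4 := by
    rw [← Finset.sum_image (f := fun d => (3 / 4 : ℝ) ^ d) (g := fun k : ℕ => ((j : ℤ) - k).natAbs)]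
    · exact hgeom _
    · intro a ha b hb hab
      simp at ha hb hab
      omega
  have h2 : ∑ k ∈ K with ¬ k ≤ j, (3 / 4 : ℝ) ^ ((j : ℤ) - k).natAbs ≤ 4 := by
    rw [← Finset.sum_image (f := fun d => (3 / 4 : ℝ) ^ d) (g := fun k : ℕ => ((j : ℤ) - k).natAbs)]
    · exact hgeom _
    · intro a ha b hb hab
      simp at ha hb hab
      omega
  linarith

/-- Summation over all scales of the bilinear estimates of Keel and Tao. -/
lemma norm_sum_sq_le_of_levels (K : Finset ℕ) (hX : ∀ n k, 0 ≤ X n k)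
    (ha : ∀ n k, ‖φ n k‖ ≤ X n k * (1 / 16) ^ k)
    (hb : ∀ n m k l, |⟪φ n k, φ m l⟫| ≤
      (1 / 4096) ^ timeScale n m * (X n k * X m l) * 4 ^ (k + l)) :
    ‖∑ n ∈ N, ∑ k ∈ K, φ n k‖ ^ 2 ≤ 2 ^ 17 * ∑ n ∈ N, ∑ k ∈ K, X n k ^ 2 := by
  obtain ⟨J, hJ⟩ : ∃ J, ∀ n ∈ N, ∀ m ∈ N, timeScale n m < J := by
    refine ⟨(N ×ˢ N).sup (fun p => timeScale p.1 p.2) + 1, fun n hn m hm => Nat.lt_succ_of_le ?_⟩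
    exact Finset.le_sup (f := fun p : ℤ × ℤ => timeScale p.1 p.2) (Finset.mk_mem_product hn hm)
  set y : ℕ → ℝ := fun k => √(∑ n ∈ N, X n k ^ 2)
  set q : ℕ → ℕ → ℝ := fun j k => (3 / 4 : ℝ) ^ ((j : ℤ) - k).natAbs with hq
  have hq0 : ∀ j k, 0 ≤ q j k := fun j k => by positivity
  have e1 : ‖∑ n ∈ N, ∑ k ∈ K, φ n k‖ ^ 2 =
      ∑ j ∈ Finset.range J, ∑ k ∈ K, ∑ l ∈ K, scalePart N φ j k l := by
    have h : ∀ k l, ∑ j ∈ Finset.range J, scalePart N φ j k l =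
        ∑ n ∈ N, ∑ m ∈ N, ⟪φ n k, φ m l⟫ := by
      intro k l
      unfold scalePart
      rw [Finset.sum_comm]
      refine Finset.sum_congr rfl fun n hn => ?_
      rw [Finset.sum_comm]
      refine Finset.sum_congr rfl fun m hm => ?_
      rw [Finset.sum_ite_eq, if_pos (Finset.mem_range.mpr (hJ n hn m hm))]
    rw [Finset.sum_comm (s := Finset.range J)]
    simp_rw [Finset.sum_comm (s := Finset.range J), h]
    rw [← real_inner_self_eq_norm_sq, Finset.sum_comm, sum_inner]
    refine Finset.sum_congr rfl fun k _ => ?_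
    rw [inner_sum]
    refine Finset.sum_congr rfl fun l _ => ?_
    rw [sum_inner]
    simp_rw [inner_sum]
  calc _ = _ := e1
    _ ≤ ∑ j ∈ Finset.range J, 2 ^ 11 * (∑ k ∈ K, q j k * y k) ^ 2 := by
      refine Finset.sum_le_sum fun j _ => ?_
      rw [sq, Finset.sum_mul_sum, Finset.mul_sum]
      refine Finset.sum_le_sum fun k _ => ?_
      rw [Finset.mul_sum]
      exact Finset.sum_le_sum fun l _ => (le_abs_self _).trans (abs_scalePart_le hX ha hb j k l)
    _ ≤ ∑ j ∈ Finset.range J, 2 ^ 14 * ∑ k ∈ K, q j k * y k ^ 2 := by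
      refine Finset.sum_le_sum fun j _ => ?_
      have h := Finset.sum_sq_le_sum_mul_sum_of_sq_le_mul K (r := fun k => q j k * y k)
        (f := fun k => q j k) (g := fun k => q j k * y k ^ 2) (fun k _ => hq0 _ _)
        (fun k _ => mul_nonneg (hq0 _ _) (sq_nonneg _)) (fun k _ => le_of_eq (by ring))
      have h0 : 0 ≤ ∑ k ∈ K, q j k * y k ^ 2 :=
        Finset.sum_nonneg fun k _ => mul_nonneg (hq0 _ _) (sq_nonneg _)
      have h1 := mul_le_mul_of_nonneg_right (sum_geom_dist_le K j) h0
      have h2 := h.trans h1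
      linarith
    _ = ∑ k ∈ K, 2 ^ 14 * ((∑ j ∈ Finset.range J, q j k) * y k ^ 2) := by
      simp_rw [Finset.mul_sum, Finset.sum_mul, Finset.mul_sum]
      rw [Finset.sum_comm]
    _ ≤ ∑ k ∈ K, 2 ^ 14 * (8 * y k ^ 2) := by
      refine Finset.sum_le_sum fun k _ => ?_
      have h : ∑ j ∈ Finset.range J, q j k ≤ 8 := by
        refine le_trans (le_of_eq (Finset.sum_congr rfl fun j _ => ?_))
          (sum_geom_dist_le (Finset.range J) k)
        rw [hq]; dsimp only
        rw [← Int.natAbs_neg, neg_sub]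
      have := mul_le_mul_of_nonneg_right h (sq_nonneg (y k))
      linarith
    _ = _ := by
      rw [Finset.sum_comm (s := N), Finset.mul_sum]
      refine Finset.sum_congr rfl fun k _ => ?_
      rw [Real.sq_sqrt (Finset.sum_nonneg fun _ _ => sq_nonneg _)]
      ring

set_option maxHeartbeats 1000000 in
/-- The endpoint estimate for discrete times, for the vectors `U n ^ (-4) * v n α ^ 5 • w n α`. -/
lemma norm_sum_sq_le_of_gram {ι : Type*} (S : Finset ι) (N : Finset ℤ) (w : ℤ → ι → H) {A : ℝ}
    (hA : 0 ≤ A)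
    (h1 : ∀ n, ∀ c : ι → ℝ, (∀ α, 0 ≤ c α) →
      ∑ α ∈ S, ∑ β ∈ S, c α * c β * |⟪w n α, w n β⟫| ≤ A * ∑ α ∈ S, c α ^ 2)
    (h2 : ∀ n m α β, |⟪w n α, w m β⟫| ≤ A * (1 / 4096) ^ timeScale n m)
    (v : ℤ → ι → ℝ) (hv : ∀ n α, 0 ≤ v n α) (U : ℤ → ℝ) (hU : ∀ n, 0 ≤ U n)
    (hUv : ∀ n, U n ^ 6 = ∑ α ∈ S, v n α ^ 6) :
    ‖∑ n ∈ N, ∑ α ∈ S, (v n α ^ 5 / U n ^ 4) • w n α‖ ^ 2 ≤ 2 ^ 41 * A * ∑ n ∈ N, U n ^ 2 := by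
  classical
  have hvU : ∀ n, ∀ α ∈ S, v n α ≤ U n := by
    intro n α hα
    refine le_of_pow_le_pow_left₀ (n := 6) (by norm_num) (hU n) ?_
    rw [hUv]
    exact Finset.single_le_sum (f := fun α => v n α ^ 6) (fun _ _ => by positivity) hα
  have hlev : ∀ n α, ∃ k : ℕ, α ∈ S → 0 < v n α →
      U n * (1 / 4) ^ (k + 1) ≤ v n α ∧ v n α ≤ U n * (1 / 4) ^ k := by
    intro n α
    by_cases h : α ∈ S ∧ 0 < v n α
    · have hU0 : 0 < U n := h.2.trans_le (hvU n α h.1)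
      obtain ⟨k, hk1, hk2⟩ := exists_nat_pow_near_of_lt_one (x := v n α / U n) (y := (1 / 4 : ℝ))
        (div_pos h.2 hU0) ((div_le_one hU0).2 (hvU n α h.1)) (by norm_num) (by norm_num)
      refine ⟨k, fun _ _ => ⟨?_, ?_⟩⟩
      · rw [lt_div_iff₀ hU0] at hk1; linarith
      · rw [div_le_iff₀ hU0] at hk2; linarith
    · exact ⟨0, fun h1 h2 => absurd ⟨h1, h2⟩ h⟩
  choose lev hlev using hlev
  set L : ℤ → ℕ → Finset ι := fun n k => S.filter fun α => 0 < v n α ∧ lev n α = k with hL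
  have hLmem : ∀ {n k α}, α ∈ L n k → α ∈ S ∧ 0 < v n α ∧
      U n * (1 / 4) ^ (k + 1) ≤ v n α ∧ v n α ≤ U n * (1 / 4) ^ k := by
    intro n k α h
    rw [hL, Finset.mem_filter] at h
    obtain ⟨h1, h2, rfl⟩ := h
    exact ⟨h1, h2, hlev n α h1 h2⟩
  set f : ℤ → ι → ℝ := fun n α => v n α ^ 5 / U n ^ 4 with hf
  have hf0 : ∀ n α, 0 ≤ f n α := fun n α => by have := hv n α; have := hU n; positivity
  have hfle : ∀ {n k α}, α ∈ L n k → f n α ≤ U n * (1 / 1024) ^ k := by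
    intro n k α h
    obtain ⟨h1, h2, _, h4⟩ := hLmem h
    have hU0 : 0 < U n := h2.trans_le (hvU n α h1)
    rw [hf]; dsimp only
    rw [div_le_iff₀ (by positivity)]
    calc v n α ^ 5 ≤ (U n * (1 / 4) ^ k) ^ 5 := pow_le_pow_left₀ h2.le h4 5
      _ = _ := by
        rw [mul_pow, ← pow_mul, mul_comm k 5, pow_mul, show (1 / 4 : ℝ) ^ 5 = 1 / 1024 by norm_num]
        ring
  set t : ℤ → ℕ → ℝ := fun n k => (L n k).card * (1 / 4096) ^ k with ht
  have ht0 : ∀ n k, 0 ≤ t n k := fun n k => by positivity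
  have htle : ∀ n k, t n k * U n ^ 6 ≤ 4096 * ∑ α ∈ L n k, v n α ^ 6 := by
    intro n k
    have : ∑ α ∈ L n k, (U n * (1 / 4) ^ (k + 1)) ^ 6 ≤ ∑ α ∈ L n k, v n α ^ 6 := by
      refine Finset.sum_le_sum fun α hα => pow_le_pow_left₀ ?_ (hLmem hα).2.2.1 6
      have := hU n; positivity
    rw [Finset.sum_const, nsmul_eq_mul, mul_pow, ← pow_mul, mul_comm (k + 1) 6, pow_mul,
      show (1 / 4 : ℝ) ^ 6 = 1 / 4096 by norm_num,
      pow_succ (1 / 4096 : ℝ) k] at this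
    rw [ht]; dsimp only
    linarith
  have hU2 : ∀ n (y : ℝ), y * U n ^ 6 ≤ 4096 * U n ^ 6 → U n ^ 2 * y ≤ 4096 * U n ^ 2 := by
    intro n y h
    rcases (hU n).eq_or_lt with h0 | h0
    · rw [← h0]; simp
    · have := le_of_mul_le_mul_right h (by positivity : 0 < U n ^ 6)
      nlinarith [sq_nonneg (U n)]
  have htL : ∀ n k, t n k ≤ 4096 := by
    intro n k
    rcases (L n k).eq_empty_or_nonempty with h | ⟨α, hα⟩
    · rw [ht]; simp [h]
    · obtain ⟨h1, h2, _, _⟩ := hLmem hα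
      have hU0 : 0 < U n := h2.trans_le (hvU n α h1)
      refine le_of_mul_le_mul_right ((htle n k).trans ?_) (by positivity : 0 < U n ^ 6)
      rw [hUv]
      exact mul_le_mul_of_nonneg_left (Finset.sum_le_sum_of_subset_of_nonneg
        (Finset.filter_subset _ _) fun α _ _ => pow_nonneg (hv n α) 6) (by norm_num)
  set B : ℝ := 64 * √A
  set X : ℤ → ℕ → ℝ := fun n k => B * U n * √(t n k) with hXdef
  have hX : ∀ n k, 0 ≤ X n k := fun n k => by have := hU n; positivity
  set φ : ℤ → ℕ → H := fun n k => ∑ α ∈ L n k, f n α • w n α with hφ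
  have ha : ∀ n k, ‖φ n k‖ ≤ X n k * (1 / 16) ^ k := by
    intro n k
    refine le_of_sq_le_sq' ?_ (mul_nonneg (hX n k) (by positivity))
    have e : ‖φ n k‖ ^ 2 ≤ A * ∑ α ∈ L n k, f n α ^ 2 := by
      have h := h1 n (fun α => if α ∈ L n k then f n α else 0)
        (fun α => by split_ifs; exacts [hf0 n α, le_rfl])
      have hs : ∀ G : ι → ℝ, ∑ α ∈ S, (if α ∈ L n k then G α else 0) = ∑ α ∈ L n k, G α := by
        intro G
        rw [← Finset.sum_filter]
        congr 1
        ext α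
        simp only [Finset.mem_filter]
        exact ⟨fun h => h.2, fun h => ⟨(hLmem h).1, h⟩⟩
      have hl : ∑ α ∈ S, ∑ β ∈ S, (if α ∈ L n k then f n α else 0) *
          (if β ∈ L n k then f n β else 0) * |⟪w n α, w n β⟫| =
          ∑ α ∈ L n k, ∑ β ∈ L n k, f n α * f n β * |⟪w n α, w n β⟫| := by
        rw [← hs]
        refine Finset.sum_congr rfl fun α _ => ?_
        split_ifs with hα
        · rw [← hs]
          refine Finset.sum_congr rfl fun β _ => ?_
          split_ifs <;> simp
        · simp
      rw [hl] at h
      simp only [ite_pow, ne_eq, OfNat.ofNat_ne_zero, not_false_eq_true, zero_pow] at h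
      rw [hs] at h
      refine le_trans ?_ h
      rw [← real_inner_self_eq_norm_sq, hφ, sum_inner]
      refine Finset.sum_le_sum fun α _ => ?_
      rw [inner_sum]
      refine Finset.sum_le_sum fun β _ => ?_
      rw [real_inner_smul_left, real_inner_smul_right, mul_assoc]
      have := le_abs_self ⟪w n α, w n β⟫
      have := hf0 n α; have := hf0 n β
      gcongr
    refine e.trans ?_
    have e2 : ∑ α ∈ L n k, f n α ^ 2 ≤ U n ^ 2 * t n k * (1 / 256) ^ k := by
      calc ∑ α ∈ L n k, f n α ^ 2 ≤ ∑ α ∈ L n k, (U n * (1 / 1024) ^ k) ^ 2 :=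
            Finset.sum_le_sum fun α hα => pow_le_pow_left₀ (hf0 n α) (hfle hα) 2
        _ = _ := by
          rw [Finset.sum_const, nsmul_eq_mul, ht]; dsimp only
          rw [mul_pow, ← pow_mul, mul_comm k 2, pow_mul, show ((1 / 1024 : ℝ)) ^ 2 =
            (1 / 4096) * (1 / 256) by norm_num, mul_pow]
          ring
    calc A * ∑ α ∈ L n k, f n α ^ 2 ≤ A * (U n ^ 2 * t n k * (1 / 256) ^ k) :=
          mul_le_mul_of_nonneg_left e2 hA
      _ ≤ 4096 * (A * (U n ^ 2 * t n k * (1 / 256) ^ k)) := by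
          have : 0 ≤ A * (U n ^ 2 * t n k * (1 / 256) ^ k) := by have := ht0 n k; positivity
          linarith
      _ = (X n k * (1 / 16) ^ k) ^ 2 := by
          rw [hXdef]; dsimp only
          rw [mul_pow, mul_pow, mul_pow, mul_pow, Real.sq_sqrt hA, Real.sq_sqrt (ht0 n k),
            ← pow_mul,
            mul_comm k 2, pow_mul]
          norm_num; ring
  have hb : ∀ n m k l, |⟪φ n k, φ m l⟫| ≤
      (1 / 4096) ^ timeScale n m * (X n k * X m l) * 4 ^ (k + l) := by
    intro n m k l
    have hc : ∀ n k, ((L n k).card : ℝ) * (1 / 1024) ^ k ≤ 64 * √(t n k) * 4 ^ k := by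
      intro n k
      have e : ((L n k).card : ℝ) * (1 / 1024) ^ k = (√(t n k) * √(t n k)) * 4 ^ k := by
        rw [Real.mul_self_sqrt (ht0 n k), ht]; dsimp only
        rw [mul_assoc, ← mul_pow]; norm_num
      rw [e]
      have h64 : √(t n k) ≤ 64 := by
        rw [Real.sqrt_le_left (by norm_num)]
        exact (htL n k).trans (by norm_num)
      gcongr
    calc |⟪φ n k, φ m l⟫| ≤ ∑ α ∈ L n k, ∑ β ∈ L m l, (U n * (1 / 1024) ^ k) *
          (U m * (1 / 1024) ^ l) * (A * (1 / 4096) ^ timeScale n m) := by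
          rw [hφ, sum_inner]
          refine (Finset.abs_sum_le_sum_abs _ _).trans (Finset.sum_le_sum fun α hα => ?_)
          rw [inner_sum]
          refine (Finset.abs_sum_le_sum_abs _ _).trans (Finset.sum_le_sum fun β hβ => ?_)
          rw [real_inner_smul_left, real_inner_smul_right, ← mul_assoc, abs_mul, abs_mul,
            abs_of_nonneg (hf0 n α), abs_of_nonneg (hf0 m β)]
          have := hf0 n α; have := hf0 m β; have := hU n; have := hU m
          have := hfle hα; have := hfle hβ; have := h2 n m α β
          gcongr
      _ = A * (1 / 4096) ^ timeScale n m * U n * U m *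
          ((((L n k).card : ℝ) * (1 / 1024) ^ k) * (((L m l).card : ℝ) * (1 / 1024) ^ l)) := by
          simp only [Finset.sum_const, nsmul_eq_mul]; ring
      _ ≤ A * (1 / 4096) ^ timeScale n m * U n * U m *
          ((64 * √(t n k) * 4 ^ k) * (64 * √(t m l) * 4 ^ l)) := by
          have := hU n; have := hU m; have := hc n k; have := hc m l
          gcongr
      _ = _ := by
          rw [hXdef]; dsimp only
          rw [pow_add]
          nth_rewrite 1 [← Real.mul_self_sqrt hA]
          ring
  set K : Finset ℕ := (N ×ˢ S).image fun p => lev p.1 p.2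
  have hφsum : ∑ n ∈ N, ∑ k ∈ K, φ n k = ∑ n ∈ N, ∑ α ∈ S, f n α • w n α := by
    refine Finset.sum_congr rfl fun n hn => ?_
    rw [hφ]; dsimp only
    have h0 : ∑ α ∈ S, f n α • w n α = ∑ α ∈ S.filter (fun α => 0 < v n α), f n α • w n α := by
      refine (Finset.sum_filter_of_ne fun α _ h => ?_).symm
      refine lt_of_le_of_ne (hv n α) fun h0 => h ?_
      rw [hf]; simp [← h0]
    rw [h0, ← Finset.sum_fiberwise_of_maps_to (t := K) (g := lev n)]
    · simp only [hL, Finset.filter_filter]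
    · intro α hα
      exact Finset.mem_image.2 ⟨(n, α), Finset.mk_mem_product hn (Finset.mem_filter.1 hα).1, rfl⟩
  have hXsum : ∀ n, ∑ k ∈ K, X n k ^ 2 ≤ 2 ^ 24 * A * U n ^ 2 := by
    intro n
    have e : ∑ k ∈ K, X n k ^ 2 = 4096 * A * (U n ^ 2 * ∑ k ∈ K, t n k) := by
      rw [Finset.mul_sum, Finset.mul_sum]
      refine Finset.sum_congr rfl fun k _ => ?_
      rw [hXdef]; dsimp only
      rw [mul_pow, mul_pow, mul_pow, Real.sq_sqrt hA, Real.sq_sqrt (ht0 n k)]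
      ring
    have e2 : (∑ k ∈ K, t n k) * U n ^ 6 ≤ 4096 * U n ^ 6 := by
      rw [Finset.sum_mul]
      refine (Finset.sum_le_sum fun k _ => htle n k).trans ?_
      rw [← Finset.mul_sum, hUv]
      refine mul_le_mul_of_nonneg_left ?_ (by norm_num)
      rw [← Finset.sum_biUnion]
      · refine Finset.sum_le_sum_of_subset_of_nonneg ?_ fun α _ _ => pow_nonneg (hv n α) 6
        intro α hα
        obtain ⟨k, _, hk⟩ := Finset.mem_biUnion.1 hα
        exact (hLmem hk).1
      · intro k _ l _ hkl
        rw [Function.onFun, Finset.disjoint_left]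
        intro α hα hα'
        exact hkl ((Finset.mem_filter.1 hα).2.2.symm.trans (Finset.mem_filter.1 hα').2.2)
    rw [e]
    have := mul_le_mul_of_nonneg_left (hU2 n _ e2) (by positivity : 0 ≤ 4096 * A)
    linarith
  have hfin := norm_sum_sq_le_of_levels (N := N) K hX ha hb
  rw [hφsum] at hfin
  refine hfin.trans ?_
  have := Finset.sum_le_sum fun n (_ : n ∈ N) => hXsum n
  rw [← Finset.mul_sum] at this
  linarith

/-- The endpoint estimate for discrete times, in the form of a bound for the coefficients. -/
lemma sum_sq_le_of_gram {ι : Type*} (S : Finset ι) (N : Finset ℤ) (w : ℤ → ι → H) {A : ℝ}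
    (hA : 0 ≤ A)
    (h1 : ∀ n, ∀ c : ι → ℝ, (∀ α, 0 ≤ c α) →
      ∑ α ∈ S, ∑ β ∈ S, c α * c β * |⟪w n α, w n β⟫| ≤ A * ∑ α ∈ S, c α ^ 2)
    (h2 : ∀ n m α β, |⟪w n α, w m β⟫| ≤ A * (1 / 4096) ^ timeScale n m)
    (v : ℤ → ι → ℝ) (hv : ∀ n α, 0 ≤ v n α) (U : ℤ → ℝ) (hU : ∀ n, 0 ≤ U n)
    (hUv : ∀ n, U n ^ 6 = ∑ α ∈ S, v n α ^ 6) (g : H) (hg : ∀ n α, ⟪g, w n α⟫ = v n α) :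
    ∑ n ∈ N, U n ^ 2 ≤ 2 ^ 41 * A * ‖g‖ ^ 2 := by
  have hmain := norm_sum_sq_le_of_gram S N w hA h1 h2 v hv U hU hUv
  have e : ⟪g, ∑ n ∈ N, ∑ α ∈ S, (v n α ^ 5 / U n ^ 4) • w n α⟫ = ∑ n ∈ N, U n ^ 2 := by
    rw [inner_sum]
    refine Finset.sum_congr rfl fun n _ => ?_
    rw [inner_sum]
    simp_rw [real_inner_smul_right, hg]
    calc ∑ α ∈ S, v n α ^ 5 / U n ^ 4 * v n α = (∑ α ∈ S, v n α ^ 6) / U n ^ 4 := by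
          rw [Finset.sum_div]
          exact Finset.sum_congr rfl fun α _ => by ring
      _ = U n ^ 2 := by
          rw [← hUv]
          rcases (hU n).eq_or_lt with h | h
          · rw [← h]; simp
          · field_simp
  set T := ∑ n ∈ N, U n ^ 2 with hT
  have hT0 : 0 ≤ T := Finset.sum_nonneg fun _ _ => sq_nonneg _
  have h3 : T ^ 2 ≤ ‖g‖ ^ 2 * (2 ^ 41 * A * T) := by
    have h := real_inner_le_norm g (∑ n ∈ N, ∑ α ∈ S, (v n α ^ 5 / U n ^ 4) • w n α)
    rw [e] at h
    calc T ^ 2 ≤ _ := pow_le_pow_left₀ hT0 h 2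
      _ = _ := mul_pow _ _ 2
      _ ≤ _ := mul_le_mul_of_nonneg_left hmain (sq_nonneg _)
  rcases hT0.eq_or_lt with h | h
  · rw [← h]; positivity
  · refine le_of_mul_le_mul_right ?_ h
    linarith

end KeelTao

open Set Filter Topology in
/-- Weierstrass' subordination formula, expressing a two-sided exponential as an average of
Gaussians. -/
lemma integral_exp_subordination {y ρ : ℝ} (hy : 0 < y) (hρ : 0 < ρ) :
    IntegrableOn (fun v : ℝ ↦ 2 * y * Real.exp (-Real.pi * (y ^ 2 * v ^ 2 + ρ ^ 2 / v ^ 2)))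
      (Ioi 0) ∧
    ∫ v in Ioi (0:ℝ), 2 * y * Real.exp (-Real.pi * (y ^ 2 * v ^ 2 + ρ ^ 2 / v ^ 2)) =
      Real.exp (-2 * Real.pi * y * ρ) := by
  set G : ℝ → ℝ := fun x ↦ Real.exp (-Real.pi * x ^ 2) with hG
  have hGc : Continuous G := by fun_prop
  have hGi : Integrable G := integrable_exp_neg_mul_sq Real.pi_pos
  set Φ : ℝ → ℝ := fun u ↦ ∫ x in (0:ℝ)..u, G x with hΦ
  have hΦd : ∀ u, HasDerivAt Φ (G u) u := fun u ↦
    intervalIntegral.integral_hasDerivAt_right (hGc.intervalIntegrable _ _)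
      (hGc.stronglyMeasurableAtFilter _ _) hGc.continuousAt
  have hhalf : ∫ x in Ioi (0:ℝ), G x = 1 / 2 := by
    have := integral_gaussian_Ioi Real.pi
    rw [div_self Real.pi_ne_zero, Real.sqrt_one] at this
    exact this
  have hΦtop : Tendsto Φ atTop (𝓝 (1 / 2)) := by
    rw [← hhalf]
    exact intervalIntegral_tendsto_integral_Ioi 0 hGi.integrableOn tendsto_id
  have hΦodd : ∀ u, Φ (-u) = - Φ u := by
    intro u
    simp only [hΦ]
    have : ∫ x in (0:ℝ)..u, G x = ∫ x in (0:ℝ)..u, G (-x) := by simp [hG]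
    rw [this, intervalIntegral.integral_comp_neg, neg_zero, intervalIntegral.integral_symm]
  have hΦbot : Tendsto Φ atBot (𝓝 (-(1 / 2))) := by
    have := (hΦtop.comp tendsto_neg_atBot_atTop).neg
    refine this.congr fun u ↦ ?_
    simp [hΦodd]
  set a := Real.exp (-2 * Real.pi * y * ρ) with ha
  set b := Real.exp (2 * Real.pi * y * ρ) with hb
  set Ψ : ℝ → ℝ := fun v ↦ a * Φ (y * v - ρ / v) + b * Φ (y * v + ρ / v) with hΨ
  have hinv : Tendsto (fun v : ℝ ↦ ρ / v) (𝓝[>] 0) atTop := by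
    simp only [div_eq_mul_inv]
    exact tendsto_inv_nhdsGT_zero.const_mul_atTop hρ
  have hlin : Tendsto (fun v : ℝ ↦ y * v) (𝓝[>] 0) (𝓝 0) := by
    have : ContinuousAt (fun v : ℝ ↦ y * v) 0 := by fun_prop
    have := this.tendsto
    rw [mul_zero] at this
    exact this.mono_left nhdsWithin_le_nhds
  have h0 : Tendsto Ψ (𝓝[>] 0) (𝓝 (a * (-(1 / 2)) + b * (1 / 2))) := by
    refine ((hΦbot.comp ?_).const_mul a).add ((hΦtop.comp ?_).const_mul b)
    · simp only [sub_eq_add_neg]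
      exact hlin.add_atBot (tendsto_neg_atTop_atBot.comp hinv)
    · exact hlin.add_atTop hinv
  have hinv' : Tendsto (fun v : ℝ ↦ ρ / v) atTop (𝓝 0) := tendsto_const_nhds.div_atTop tendsto_id
  have hlin' : Tendsto (fun v : ℝ ↦ y * v) atTop atTop := tendsto_id.const_mul_atTop hy
  have h1 : Tendsto Ψ atTop (𝓝 (a * (1 / 2) + b * (1 / 2))) := by
    refine ((hΦtop.comp ?_).const_mul a).add ((hΦtop.comp ?_).const_mul b)
    · simp only [sub_eq_add_neg]
      exact hlin'.atTop_add hinv'.neg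
    · exact hlin'.atTop_add hinv'
  have hd : ∀ v ∈ Ioi (0:ℝ), HasDerivAt Ψ
      (2 * y * Real.exp (-Real.pi * (y ^ 2 * v ^ 2 + ρ ^ 2 / v ^ 2))) v := by
    intro v hv
    have hv0 : v ≠ 0 := (mem_Ioi.1 hv).ne'
    have e1 : HasDerivAt (fun v : ℝ ↦ y * v) y v := by simpa using (hasDerivAt_id v).const_mul y
    have e2 : HasDerivAt (fun v : ℝ ↦ ρ / v) (ρ * (-(v ^ 2)⁻¹)) v := by
      simpa only [div_eq_mul_inv] using (hasDerivAt_inv hv0).const_mul ρ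
    have e3 := ((hΦd (y * v - ρ / v)).comp v (e1.sub e2)).const_mul a
    have e4 := ((hΦd (y * v + ρ / v)).comp v (e1.add e2)).const_mul b
    refine (e3.add e4).congr_deriv ?_
    have k1 : a * G (y * v - ρ / v) = Real.exp (-Real.pi * (y ^ 2 * v ^ 2 + ρ ^ 2 / v ^ 2)) := by
      rw [ha, hG, ← Real.exp_add]
      congr 1
      field_simp
      ring
    have k2 : b * G (y * v + ρ / v) = Real.exp (-Real.pi * (y ^ 2 * v ^ 2 + ρ ^ 2 / v ^ 2)) := by
      rw [hb, hG, ← Real.exp_add]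
      congr 1
      field_simp
      ring
    rw [← mul_assoc, ← mul_assoc, k1, k2]
    ring
  set g : ℝ → ℝ := Function.update Ψ 0 (a * (-(1 / 2)) + b * (1 / 2)) with hg
  have hgΨ : ∀ v ∈ Ioi (0:ℝ), g =ᶠ[𝓝 v] Ψ := by
    intro v hv
    filter_upwards [Ioi_mem_nhds hv] with w hw
    exact Function.update_of_ne (mem_Ioi.1 hw).ne' _ _
  have hgd : ∀ v ∈ Ioi (0:ℝ), HasDerivAt g
      (2 * y * Real.exp (-Real.pi * (y ^ 2 * v ^ 2 + ρ ^ 2 / v ^ 2))) v := fun v hv ↦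
    (hd v hv).congr_of_eventuallyEq (hgΨ v hv)
  have hgc : ContinuousWithinAt g (Ici 0) 0 := by
    rw [hg, continuousWithinAt_update_same]
    refine h0.mono_left (nhdsWithin_mono _ ?_)
    rintro x ⟨hx, hx'⟩
    exact lt_of_le_of_ne hx (Ne.symm hx')
  have hgt : Tendsto g atTop (𝓝 (a * (1 / 2) + b * (1 / 2))) := by
    refine h1.congr' ?_
    filter_upwards [Ioi_mem_atTop (0:ℝ)] with v hv
    exact (Function.update_of_ne (mem_Ioi.1 hv).ne' _ _).symm
  have hpos : ∀ v ∈ Ioi (0:ℝ), 0 ≤ 2 * y * Real.exp (-Real.pi * (y ^ 2 * v ^ 2 + ρ ^ 2 / v ^ 2)) :=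
    fun v _ ↦ by positivity
  refine ⟨integrableOn_Ioi_deriv_of_nonneg hgc hgd hpos hgt, ?_⟩
  rw [integral_Ioi_of_hasDerivAt_of_nonneg hgc hgd hpos hgt, hg, Function.update_self]
  ring

lemma integrable_exp_neg_mul_norm {c : ℝ} (hc : 0 < c) :
    Integrable (fun ξ : Sp ↦ Real.exp (-c * ‖ξ‖)) := by
  have h5 : Integrable (fun ξ : Sp ↦ (1 + ‖ξ‖) ^ (-(5:ℝ))) := by
    apply integrable_one_add_norm
    simp
    norm_num
  refine ((h5.const_mul (Real.exp c * (Nat.factorial 5 / c ^ 5))).mono' ?_ ?_)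
  · exact Continuous.aestronglyMeasurable (by fun_prop)
  · refine Filter.Eventually.of_forall fun ξ ↦ ?_
    rw [Real.norm_of_nonneg (Real.exp_pos _).le]
    have hp : 0 < 1 + ‖ξ‖ := by positivity
    have := Real.pow_div_factorial_le_exp (c * (1 + ‖ξ‖)) (by positivity) 5
    rw [Real.rpow_neg hp.le]
    have e : (1 + ‖ξ‖) ^ (5:ℝ) = (1 + ‖ξ‖) ^ (5:ℕ) := by
      exact_mod_cast Real.rpow_natCast (1 + ‖ξ‖) 5
    rw [e]
    have e2 : Real.exp (-c * ‖ξ‖) = Real.exp c * (Real.exp (c * (1 + ‖ξ‖)))⁻¹ := by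
      rw [← Real.exp_neg, ← Real.exp_add]; ring_nf
    rw [e2, mul_assoc]
    refine mul_le_mul_of_nonneg_left ?_ (Real.exp_pos _).le
    calc (Real.exp (c * (1 + ‖ξ‖)))⁻¹ ≤ ((c * (1 + ‖ξ‖)) ^ 5 / (Nat.factorial 5 : ℝ))⁻¹ := by
          apply inv_anti₀ (by positivity) this
      _ = _ := by rw [inv_div]; field_simp

/-- The constant in the Poisson kernel of the upper half-space over `ℝ⁴`. -/
def poissonConst : ℝ := Real.pi ^ (-(5/2) : ℝ) * Real.Gamma (5/2)

lemma poissonConst_pos : 0 < poissonConst :=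
  mul_pos (Real.rpow_pos_of_pos Real.pi_pos _) (Real.Gamma_pos_of_pos (by norm_num))

open Set in
lemma integral_pow_four_mul_exp {y : ℝ} (hy : 0 < y) (x : Sp) :
    ∫ v in Ioi (0:ℝ), 2 * y * (v ^ 4 * Real.exp (-(Real.pi * (y ^ 2 + ‖x‖ ^ 2)) * v ^ 2)) =
      poissonConst * (y * (y ^ 2 + ‖x‖ ^ 2) ^ (-(5/2) : ℝ)) := by
  have hb : 0 < y ^ 2 + ‖x‖ ^ 2 := by positivity
  have := _root_.integral_rpow_mul_exp_neg_mul_rpow (p := 2) (q := 4)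
    (b := Real.pi * (y ^ 2 + ‖x‖ ^ 2))
    (by norm_num) (by norm_num) (by positivity)
  rw [integral_const_mul]
  rw [show (-(4 + 1) / 2 : ℝ) = -(5 / 2) by norm_num, show ((4 + 1) / 2 : ℝ) = 5 / 2 by norm_num]
    at this
  simp only [Real.rpow_ofNat] at this
  rw [this, Real.mul_rpow Real.pi_pos.le hb.le, poissonConst]
  ring

open Set in
/-- The Poisson kernel on `ℝ⁴` as an inverse Fourier transform. -/
lemma integral_poisson_real {y : ℝ} (hy : 0 < y) (x : Sp) :
    ∫ ξ : Sp, cexp (2 * Real.pi * I * (⟪x, ξ⟫ : ℝ) - 2 * Real.pi * y * ‖ξ‖) =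
      ((poissonConst * (y * (y ^ 2 + ‖x‖ ^ 2) ^ (-(5/2) : ℝ)) : ℝ) : ℂ) := by
  set k : Sp → ℝ → ℂ := fun ξ v ↦
    cexp (2 * Real.pi * I * (⟪x, ξ⟫ : ℝ)) *
      ((2 * y * Real.exp (-Real.pi * (y ^ 2 * v ^ 2 + ‖ξ‖ ^ 2 / v ^ 2)) : ℝ) : ℂ) with hk
  have hph : ∀ ξ : Sp, ‖cexp (2 * Real.pi * I * (⟪x, ξ⟫ : ℝ))‖ = 1 := by
    intro ξ
    have : (2 * Real.pi * I * (⟪x, ξ⟫ : ℝ) : ℂ) = ((2 * Real.pi * ⟪x, ξ⟫ : ℝ) : ℂ) * I := by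
      push_cast; ring
    rw [this, Complex.norm_exp_ofReal_mul_I]
  have hne : ∀ᵐ ξ : Sp, ξ ≠ 0 := by
    simp [ae_iff]
  have h1 : ∀ᵐ ξ : Sp, ∫ v in Ioi (0:ℝ), k ξ v =
      cexp (2 * Real.pi * I * (⟪x, ξ⟫ : ℝ) - 2 * Real.pi * y * ‖ξ‖) := by
    filter_upwards [hne] with ξ hξ
    simp only [hk]
    rw [integral_const_mul, integral_complex_ofReal,
      (integral_exp_subordination hy (norm_pos_iff.2 hξ)).2, Complex.ofReal_exp, ← Complex.exp_add]
    congr 1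
    push_cast
    ring
  have hnorm : ∀ ξ v, ‖k ξ v‖ =
      2 * y * Real.exp (-Real.pi * (y ^ 2 * v ^ 2 + ‖ξ‖ ^ 2 / v ^ 2)) := by
    intro ξ v
    simp only [hk]
    rw [norm_mul, hph, one_mul, Complex.norm_real, Real.norm_of_nonneg (by positivity)]
  have hmeas : Measurable (Function.uncurry k) := by
    simp only [hk, Function.uncurry_def]
    fun_prop
  have h_int : Integrable (Function.uncurry k) ((volume : Measure Sp).prod
      (volume.restrict (Ioi (0:ℝ)))) := by
    rw [integrable_prod_iff hmeas.aestronglyMeasurable]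
    constructor
    · filter_upwards [hne] with ξ hξ
      simp only [hk, Function.uncurry]
      exact ((integral_exp_subordination hy (norm_pos_iff.2 hξ)).1.ofReal).const_mul _
    · refine (integrable_exp_neg_mul_norm (c := 2 * Real.pi * y) (by positivity)).congr ?_
      filter_upwards [hne] with ξ hξ
      simp only [Function.uncurry, hnorm]
      rw [(integral_exp_subordination hy (norm_pos_iff.2 hξ)).2]
      ring_nf
  rw [← integral_congr_ae h1, integral_integral_swap h_int]
  rw [← integral_pow_four_mul_exp hy x, ← integral_complex_ofReal]
  refine setIntegral_congr_fun measurableSet_Ioi fun v hv ↦ ?_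
  have hv : 0 < v := hv
  have hg := GaussianFourier.integral_cexp_neg_mul_sq_norm_add (V := Sp)
    (b := ((Real.pi / v ^ 2 : ℝ) : ℂ)) (by rw [Complex.ofReal_re]; positivity)
    (2 * Real.pi * I) x
  have hvc : (v : ℂ) ≠ 0 := by exact_mod_cast hv.ne'
  have e1 : ∀ ξ : Sp, k ξ v = ((2 * y * Real.exp (-Real.pi * (y ^ 2 * v ^ 2)) : ℝ) : ℂ) *
      cexp (-((Real.pi / v ^ 2 : ℝ) : ℂ) * ‖ξ‖ ^ 2 + 2 * Real.pi * I * ⟪x, ξ⟫) := by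
    intro ξ
    simp only [hk]
    push_cast
    rw [mul_left_comm, ← Complex.exp_add, mul_assoc (2 * (y : ℂ)), ← Complex.exp_add]
    congr 2
    field_simp
    ring
  simp only [e1]
  rw [integral_const_mul, hg]
  have hpi : (Real.pi : ℂ) ≠ 0 := by exact_mod_cast Real.pi_ne_zero
  have e2 : (Real.pi : ℂ) / ((Real.pi / v ^ 2 : ℝ) : ℂ) = (v:ℂ) ^ 2 := by
    push_cast
    field_simp
  have e3 : ((Module.finrank ℝ Sp : ℂ) / 2) = (2:ℕ) := by
    simp; norm_num
  rw [e2, e3, Complex.cpow_natCast]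
  push_cast
  rw [show ((v:ℂ) ^ 2) ^ 2 = v ^ 4 by ring, mul_assoc, mul_left_comm (cexp _), ← Complex.exp_add]
  congr 3
  have : (I:ℂ) ^ 2 = -1 := I_sq
  field_simp
  rw [this]
  ring

/-- The integral kernel of `e^{-2π z √(-Δ)}` on `ℝ⁴`, defined through its symbol. -/
def waveKernel (z : ℂ) (x : Sp) : ℂ :=
  ∫ ξ : Sp, cexp (2 * Real.pi * I * (⟪x, ξ⟫ : ℝ) - 2 * Real.pi * z * ‖ξ‖)

lemma norm_cexp_waveKernel (z : ℂ) (x ξ : Sp) :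
    ‖cexp (2 * Real.pi * I * (⟪x, ξ⟫ : ℝ) - 2 * Real.pi * z * ‖ξ‖)‖ =
      Real.exp (-(2 * Real.pi * z.re) * ‖ξ‖) := by
  rw [Complex.norm_exp]
  congr 1
  simp

lemma integrable_waveKernel {z : ℂ} (hz : 0 < z.re) (x : Sp) :
    Integrable fun ξ : Sp ↦ cexp (2 * Real.pi * I * (⟪x, ξ⟫ : ℝ) - 2 * Real.pi * z * ‖ξ‖) := by
  refine (integrable_exp_neg_mul_norm (c := 2 * Real.pi * z.re) (by positivity)).mono' ?_ ?_
  · exact Continuous.aestronglyMeasurable (by fun_prop)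
  · exact Filter.Eventually.of_forall fun ξ ↦ (norm_cexp_waveKernel z x ξ).le

lemma differentiableAt_waveKernel {z : ℂ} (hz : 0 < z.re) (x : Sp) :
    DifferentiableAt ℂ (fun z ↦ waveKernel z x) z := by
  have hs : Metric.ball z (z.re / 2) ∈ nhds z := Metric.ball_mem_nhds _ (by positivity)
  have hre : ∀ w ∈ Metric.ball z (z.re / 2), z.re / 2 ≤ w.re := by
    intro w hw
    have h1 : |(w - z).re| ≤ ‖w - z‖ := Complex.abs_re_le_norm _
    rw [Metric.mem_ball, dist_eq_norm] at hw
    have := (abs_le.1 h1).1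
    rw [Complex.sub_re] at this
    linarith
  have hb : Integrable (fun ξ : Sp ↦ 2 * Real.pi * (2 / (Real.pi * z.re)) *
      Real.exp (-(Real.pi * z.re / 2) * ‖ξ‖)) :=
    (integrable_exp_neg_mul_norm (c := Real.pi * z.re / 2) (by positivity)).const_mul _
  refine (hasDerivAt_integral_of_dominated_loc_of_deriv_le (𝕜 := ℂ) hs
    (F := fun z ξ ↦ cexp (2 * Real.pi * I * (⟪x, ξ⟫ : ℝ) - 2 * Real.pi * z * ‖ξ‖))
    (F' := fun z ξ ↦ cexp (2 * Real.pi * I * (⟪x, ξ⟫ : ℝ) - 2 * Real.pi * z * ‖ξ‖) *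
      (-(2 * Real.pi * ‖ξ‖))) ?_ (integrable_waveKernel hz x) ?_ ?_ hb ?_).2.differentiableAt
  · exact Filter.Eventually.of_forall fun w ↦ Continuous.aestronglyMeasurable (by fun_prop)
  · exact Continuous.aestronglyMeasurable (by fun_prop)
  · refine Filter.Eventually.of_forall fun ξ w hw ↦ ?_
    rw [norm_mul, norm_cexp_waveKernel, norm_neg]
    have e1 : ‖(2 * Real.pi * ‖ξ‖ : ℂ)‖ = 2 * Real.pi * ‖ξ‖ := by
      simp [abs_of_pos Real.pi_pos]
    rw [e1]
    have h1 : Real.exp (-(2 * Real.pi * w.re) * ‖ξ‖) ≤ Real.exp (-(Real.pi * z.re) * ‖ξ‖) := by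
      apply Real.exp_le_exp.2
      have := hre w hw
      have h2 : z.re * ‖ξ‖ ≤ 2 * w.re * ‖ξ‖ :=
        mul_le_mul_of_nonneg_right (by linarith) (norm_nonneg _)
      nlinarith [Real.pi_pos]
    have h2 : ‖ξ‖ ≤ 2 / (Real.pi * z.re) * Real.exp (Real.pi * z.re / 2 * ‖ξ‖) := by
      have := Real.add_one_le_exp (Real.pi * z.re / 2 * ‖ξ‖)
      have hp : 0 < Real.pi * z.re := by positivity
      rw [div_mul_eq_mul_div, le_div_iff₀ hp]
      linarith
    have h3 : Real.exp (-(Real.pi * z.re) * ‖ξ‖) * Real.exp (Real.pi * z.re / 2 * ‖ξ‖) =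
        Real.exp (-(Real.pi * z.re / 2) * ‖ξ‖) := by
      rw [← Real.exp_add]; ring_nf
    calc _ ≤ Real.exp (-(Real.pi * z.re) * ‖ξ‖) *
          (2 * Real.pi * (2 / (Real.pi * z.re) * Real.exp (Real.pi * z.re / 2 * ‖ξ‖))) := by
          gcongr
      _ = _ := by rw [← h3]; ring
  · refine Filter.Eventually.of_forall fun ξ w hw ↦ ?_
    refine HasDerivAt.cexp ?_
    have := (((hasDerivAt_id w).const_mul (2 * Real.pi : ℂ)).mul_const (‖ξ‖ : ℂ)).const_sub
      (2 * Real.pi * I * (⟪x, ξ⟫ : ℝ))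
    simpa using this

lemma sq_add_mem_slitPlane {z : ℂ} (hz : 0 < z.re) (r : ℝ) : z ^ 2 + (r : ℂ) ^ 2 ∈ slitPlane := by
  rw [mem_slitPlane_iff]
  have h1 : (z ^ 2 + (r : ℂ) ^ 2).re = z.re ^ 2 - z.im ^ 2 + r ^ 2 := by
    simp [pow_two]
  have h2 : (z ^ 2 + (r : ℂ) ^ 2).im = 2 * z.re * z.im := by
    simp [pow_two]; ring
  rw [h1, h2]
  by_cases h : z.im = 0
  · left
    rw [h]
    nlinarith [sq_nonneg r, pow_pos hz 2]
  · right
    exact mul_ne_zero (by positivity) h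

open Filter Topology in
/-- The explicit form of the wave kernel: the analytic continuation of the Poisson kernel. -/
lemma waveKernel_eq {z : ℂ} (hz : 0 < z.re) (x : Sp) :
    waveKernel z x =
      poissonConst * (z * (z ^ 2 + (‖x‖ : ℂ) ^ 2) ^ ((-(5 / 2) : ℝ) : ℂ)) := by
  set U : Set ℂ := {z | 0 < z.re} with hU
  have hUo : IsOpen U := isOpen_lt continuous_const Complex.continuous_re
  have hUc : IsPreconnected U := (convex_halfSpace_re_gt 0).isPreconnected
  have hF : AnalyticOnNhd ℂ (fun z ↦ waveKernel z x) U :=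
    DifferentiableOn.analyticOnNhd
      (fun w hw ↦ (differentiableAt_waveKernel hw x).differentiableWithinAt) hUo
  have hG : AnalyticOnNhd ℂ (fun z : ℂ ↦
      poissonConst * (z * (z ^ 2 + (‖x‖ : ℂ) ^ 2) ^ ((-(5 / 2) : ℝ) : ℂ))) U := by
    refine DifferentiableOn.analyticOnNhd (fun w hw ↦ ?_) hUo
    refine DifferentiableAt.differentiableWithinAt ?_
    refine DifferentiableAt.const_mul (differentiableAt_id.mul ?_) _
    exact DifferentiableAt.cpow_const (by fun_prop) (sq_add_mem_slitPlane hw _)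
  refine hF.eqOn_of_preconnected_of_frequently_eq hG hUc (z₀ := 1) (by simp [hU]) ?_ hz
  have ht : Tendsto (fun y : ℝ ↦ (y : ℂ)) (𝓝[≠] 1) (𝓝[≠] 1) := by
    refine tendsto_nhdsWithin_of_tendsto_nhds_of_eventually_within _ ?_ ?_
    · have : Tendsto (fun y : ℝ ↦ (y : ℂ)) (𝓝 1) (𝓝 ((1 : ℝ) : ℂ)) :=
        Complex.continuous_ofReal.tendsto 1
      rw [Complex.ofReal_one] at this
      exact this.mono_left nhdsWithin_le_nhds
    · filter_upwards [self_mem_nhdsWithin] with y hy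
      simpa using hy
  refine ht.frequently (Eventually.frequently ?_)
  have : ∀ᶠ y : ℝ in 𝓝[≠] 1, 0 < y := nhdsWithin_le_nhds (Ioi_mem_nhds one_pos)
  filter_upwards [this] with y hy
  rw [waveKernel, integral_poisson_real hy x]
  have hb : 0 ≤ y ^ 2 + ‖x‖ ^ 2 := by positivity
  push_cast [Complex.ofReal_cpow hb]
  rfl

/-- The wave kernel concentrates near the light cone. -/
lemma norm_waveKernel_le {s : ℝ} (hs : 1 ≤ |s|) (x : Sp) :
    ‖waveKernel (1 - I * s) x‖ ≤
      2 * poissonConst * |s| ^ (-(3 / 2) : ℝ) * (1 + (‖x‖ - |s|) ^ 2)⁻¹ := by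
  have hz : 0 < (1 - I * s : ℂ).re := by simp
  have hs0 : 0 < |s| := by linarith
  set A : ℝ := 1 + (‖x‖ - |s|) ^ 2 with hA
  set B : ℝ := 1 + (‖x‖ + |s|) ^ 2 with hB
  have hA1 : 1 ≤ A := by rw [hA]; nlinarith [sq_nonneg (‖x‖ - |s|)]
  have hBs : |s| ^ 2 ≤ B := by rw [hB]; nlinarith [norm_nonneg x]
  have hB0 : 0 < B := by rw [hB]; positivity
  have hnz : ‖(1 - I * s : ℂ)‖ ≤ 2 * |s| := by
    calc ‖(1 - I * s : ℂ)‖ ≤ ‖(1 : ℂ)‖ + ‖I * (s : ℂ)‖ := norm_sub_le _ _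
      _ = 1 + |s| := by simp
      _ ≤ _ := by linarith
  have hsq : ‖(1 - I * s : ℂ) ^ 2 + (‖x‖ : ℂ) ^ 2‖ ^ 2 = A * B := by
    rw [← Complex.normSq_eq_norm_sq, Complex.normSq_apply]
    have h1 : ((1 - I * s : ℂ) ^ 2 + (‖x‖ : ℂ) ^ 2).re = 1 - s ^ 2 + ‖x‖ ^ 2 := by
      simp [pow_two]
    have h2 : ((1 - I * s : ℂ) ^ 2 + (‖x‖ : ℂ) ^ 2).im = -2 * s := by
      simp [pow_two]; ring
    rw [h1, h2, hA, hB, ← sq_abs s]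
    have := sq_abs s
    linear_combination 4 * (-this)
  have hnorm : ‖((1 - I * s : ℂ) ^ 2 + (‖x‖ : ℂ) ^ 2) ^ ((-(5 / 2) : ℝ) : ℂ)‖ =
      A ^ (-(5 / 4) : ℝ) * B ^ (-(5 / 4) : ℝ) := by
    rw [Complex.norm_cpow_real, ← Real.mul_rpow (by linarith) hB0.le, ← hsq,
      ← Real.rpow_natCast, ← Real.rpow_mul (norm_nonneg _)]
    norm_num
  rw [waveKernel_eq hz, norm_mul, norm_mul, hnorm, Complex.norm_real,
    Real.norm_of_nonneg poissonConst_pos.le]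
  have h1 : A ^ (-(5 / 4) : ℝ) ≤ A⁻¹ := by
    rw [← Real.rpow_neg_one]
    exact Real.rpow_le_rpow_of_exponent_le hA1 (by norm_num)
  have h2 : B ^ (-(5 / 4) : ℝ) ≤ |s| ^ (-(5 / 2) : ℝ) := by
    calc B ^ (-(5 / 4) : ℝ) ≤ (|s| ^ 2) ^ (-(5 / 4) : ℝ) :=
          Real.rpow_le_rpow_of_nonpos (by positivity) hBs (by norm_num)
      _ = _ := by
        rw [← Real.rpow_natCast, ← Real.rpow_mul hs0.le]
        norm_num
  have h3 : |s| * |s| ^ (-(5 / 2) : ℝ) = |s| ^ (-(3 / 2) : ℝ) := by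
    rw [← Real.rpow_one_add' hs0.le (by norm_num)]
    norm_num
  calc _ ≤ poissonConst * (2 * |s| * (A⁻¹ * |s| ^ (-(5 / 2) : ℝ))) := by
        have := poissonConst_pos.le
        have : 0 ≤ A := by linarith
        gcongr
    _ = _ := by rw [← h3]; ring

lemma norm_waveKernel_one (x : Sp) :
    ‖waveKernel 1 x‖ = poissonConst * (1 + ‖x‖ ^ 2) ^ (-(5 / 2) : ℝ) := by
  rw [waveKernel_eq (by simp), norm_mul, norm_mul, Complex.norm_cpow_real, Complex.norm_real,
    Real.norm_of_nonneg poissonConst_pos.le]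
  have : ‖(1 : ℂ) ^ 2 + (‖x‖ : ℂ) ^ 2‖ = 1 + ‖x‖ ^ 2 := by
    rw [show (1 : ℂ) ^ 2 + (‖x‖ : ℂ) ^ 2 = ((1 + ‖x‖ ^ 2 : ℝ) : ℂ) by push_cast; ring,
      Complex.norm_real, Real.norm_of_nonneg (by positivity)]
  rw [this]
  simp

lemma lintegral_inv_one_add_sq_sub (s₀ : ℝ) :
    ∫⁻ s : ℝ, ENNReal.ofReal ((1 + (s - s₀) ^ 2)⁻¹) = ENNReal.ofReal Real.pi := by
  rw [lintegral_sub_right_eq_self (fun s : ℝ ↦ ENNReal.ofReal ((1 + s ^ 2)⁻¹)) s₀,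
    ← ofReal_integral_eq_lintegral_ofReal integrable_inv_one_add_sq
      (Filter.Eventually.of_forall fun s ↦ by positivity), integral_univ_inv_one_add_sq]

/-- A function which expands distances on `A` spends little time near any given level. -/
lemma lintegral_indicator_inv_one_add_sq_le (A : Set ℝ) (h : ℝ → ℝ) (τ : ℝ)
    (hh : ∀ s ∈ A, ∀ s' ∈ A, |s - s'| ≤ 2 * |h s - h s'|) :
    ∫⁻ s : ℝ, A.indicator (fun s ↦ ENNReal.ofReal ((1 + (h s - τ) ^ 2)⁻¹)) s ≤
      ENNReal.ofReal (32 * Real.pi) := by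
  rcases A.eq_empty_or_nonempty with rfl | hA
  · simp
  obtain ⟨s₀, hs₀, hmin⟩ : ∃ s₀ ∈ A, ∀ s ∈ A, |h s₀ - τ| ≤ |h s - τ| + 1 := by
    have hbdd : BddBelow ((fun s ↦ |h s - τ|) '' A) := ⟨0, by rintro _ ⟨s, _, rfl⟩; positivity⟩
    obtain ⟨_, ⟨s₀, hs₀, rfl⟩, hlt⟩ := exists_lt_of_csInf_lt (hA.image (fun s ↦ |h s - τ|))
      (lt_add_one (sInf ((fun s ↦ |h s - τ|) '' A)))
    refine ⟨s₀, hs₀, fun s hs ↦ ?_⟩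
    have := csInf_le hbdd (Set.mem_image_of_mem (fun s ↦ |h s - τ|) hs)
    dsimp only at hlt this
    linarith
  rw [ENNReal.ofReal_mul (by norm_num), ← lintegral_inv_one_add_sq_sub s₀,
    ← lintegral_const_mul' _ _ ENNReal.ofReal_ne_top]
  refine lintegral_mono fun s ↦ ?_
  by_cases hs : s ∈ A
  · rw [Set.indicator_of_mem hs, ← ENNReal.ofReal_mul (by norm_num)]
    apply ENNReal.ofReal_le_ofReal
    have h1 := hh s hs s₀ hs₀
    have h2 : |h s - h s₀| ≤ |h s - τ| + |h s₀ - τ| := by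
      have := abs_sub (h s - τ) (h s₀ - τ)
      rwa [sub_sub_sub_cancel_right] at this
    have h3 : |s - s₀| ≤ 4 * |h s - τ| + 2 := by linarith [hmin s hs]
    have h4 : |s - s₀| ^ 2 ≤ (4 * |h s - τ| + 2) ^ 2 := by gcongr
    rw [sq_abs] at h4
    rw [← sq_abs (h s - τ), ← div_eq_mul_inv, inv_eq_one_div,
      div_le_div_iff₀ (by positivity) (by positivity)]
    nlinarith [sq_nonneg (|h s - τ| - 1), sq_nonneg (4 * |h s - τ| - 2)]
  · rw [Set.indicator_of_notMem hs]
    exact zero_le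

lemma norm_sq_sub_insertNth (x : Sp) (i : Fin 4) (s : ℝ) (z : Fin 3 → ℝ) :
    ‖x - WithLp.toLp 2 (i.insertNth (α := fun _ ↦ ℝ) s z)‖ ^ 2 =
      (x i - s) ^ 2 + ∑ j, (x (i.succAbove j) - z j) ^ 2 := by
  rw [EuclideanSpace.norm_sq_eq, Fin.sum_univ_succAbove _ i]
  simp

lemma measurableSet_cube (μ : ℝ) (a : Fin 4 → ℤ) : MeasurableSet (cube μ a) := by
  have : cube μ a =
      ⋂ i : Fin 4, ({x : Sp | (a i : ℝ) ≤ μ * x i} ∩ {x : Sp | μ * x i < a i + 1}) := by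
    ext x
    simp [cube]
  rw [this]
  refine MeasurableSet.iInter fun i ↦ ?_
  exact (measurableSet_le (f := fun _ : Sp ↦ (a i : ℝ)) (by fun_prop) (by fun_prop)).inter
    (measurableSet_lt (g := fun _ : Sp ↦ (a i + 1 : ℝ)) (by fun_prop) (by fun_prop))

lemma lintegral_cube_le {μ : ℝ} (hμ : 0 < μ) (a : Fin 4 → ℤ) {F : Sp → ℝ≥0∞} (hF : Measurable F)
    (i : Fin 4) {D : ℝ≥0∞}
    (hD : ∀ z : Fin 3 → ℝ, ∫⁻ s : ℝ, F (WithLp.toLp 2 (i.insertNth (α := fun _ ↦ ℝ) s z)) ≤ D) :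
    ∫⁻ y in cube μ a, F y ≤ D * ENNReal.ofReal (μ⁻¹ ^ 3) := by
  set V : Set (Fin 3 → ℝ) := Set.pi Set.univ
    (fun j ↦ Set.Ico (a (i.succAbove j) / μ) ((a (i.succAbove j) + 1) / μ)) with hV
  have hVm : MeasurableSet V := MeasurableSet.univ_pi fun j ↦ measurableSet_Ico
  have hVvol : volume V = ENNReal.ofReal (μ⁻¹ ^ 3) := by
    rw [hV, volume_pi_pi]
    simp only [Real.volume_Ico, ← sub_div, add_sub_cancel_left, Finset.prod_const,
      Finset.card_univ, Fintype.card_fin]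
    rw [ENNReal.ofReal_pow (by positivity), one_div]
  have hFc : Measurable ((cube μ a).indicator F) := hF.indicator (measurableSet_cube μ a)
  have hins : Measurable fun p : ℝ × (Fin 3 → ℝ) ↦ i.insertNth (α := fun _ ↦ ℝ) p.1 p.2 :=
    (MeasurableEquiv.piFinSuccAbove (fun _ : Fin 4 ↦ ℝ) i).symm.measurable
  have hlp : Measurable (WithLp.toLp 2 : (Fin 4 → ℝ) → Sp) :=
    (MeasurableEquiv.toLp 2 (Fin 4 → ℝ)).measurable
  rw [← lintegral_indicator (measurableSet_cube μ a),
    ← (PiLp.volume_preserving_toLp (Fin 4)).lintegral_comp hFc]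
  refine (((volume_preserving_piFinSuccAbove (fun _ : Fin 4 ↦ ℝ) i).symm _).lintegral_comp
      (hFc.comp hlp)).symm.trans_le ?_
  rw [Measure.volume_eq_prod]
  refine (lintegral_prod_symm _ ((hFc.comp hlp).comp hins).aemeasurable).trans_le ?_
  rw [← hVvol, ← setLIntegral_const, ← lintegral_indicator hVm]
  refine lintegral_mono fun z ↦ ?_
  by_cases hz : z ∈ V
  · rw [Set.indicator_of_mem hz]
    refine (lintegral_mono fun s ↦ ?_).trans (hD z)
    exact Set.indicator_le_self _ _ _
  · rw [Set.indicator_of_notMem hz]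
    refine le_of_eq ((lintegral_congr fun s ↦ Set.indicator_of_notMem ?_ _).trans lintegral_zero)
    intro hc
    apply hz
    intro j _
    have := hc (i.succAbove j)
    rw [Set.mem_Ico, div_le_iff₀ hμ, lt_div_iff₀ hμ, mul_comm]
    simpa using this

lemma abs_sub_le_two_mul_abs_sub {u v h k b : ℝ} (hu : 0 ≤ u) (hv : 0 ≤ v) (hh : 0 ≤ h)
    (hk : 0 ≤ k) (h1 : h ^ 2 = u ^ 2 + b) (k1 : k ^ 2 = v ^ 2 + b) (h2 : h ^ 2 ≤ 4 * u ^ 2)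
    (k2 : k ^ 2 ≤ 4 * v ^ 2) : |u - v| ≤ 2 * |h - k| := by
  have h3 : h ≤ 2 * u := abs_le_of_sq_le_sq' (by nlinarith) (by linarith) |>.2
  have k3 : k ≤ 2 * v := abs_le_of_sq_le_sq' (by nlinarith) (by linarith) |>.2
  rcases (add_nonneg hu hv).eq_or_lt with h0 | h0
  · have : u = 0 := by linarith
    have : v = 0 := by linarith
    subst u v
    simp
  have e : |u - v| * (u + v) = |h - k| * (h + k) := by
    have := congrArg abs (show (u - v) * (u + v) = (h - k) * (h + k) by
      linear_combination k1 - h1)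
    rwa [abs_mul, abs_mul, abs_of_nonneg (add_nonneg hu hv), abs_of_nonneg (add_nonneg hh hk)]
      at this
  have : |u - v| * (u + v) ≤ (2 * |h - k|) * (u + v) := by
    rw [e]
    nlinarith [abs_nonneg (h - k)]
  exact le_of_mul_le_mul_right this h0

/-- A spherical shell of unit thickness meets a cube of side length `1/μ` in a set of measure
`O(μ⁻³)`, uniformly in the radius of the shell. -/
lemma lintegral_cube_shell_le {μ : ℝ} (hμ : 0 < μ) (a : Fin 4 → ℤ) (x : Sp) (τ : ℝ) :
    ∫⁻ y in cube μ a, ENNReal.ofReal ((1 + (‖x - y‖ - τ) ^ 2)⁻¹) ≤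
      ENNReal.ofReal (256 * Real.pi * μ⁻¹ ^ 3) := by
  set k : Sp → ℝ≥0∞ := fun y ↦ ENNReal.ofReal ((1 + (‖x - y‖ - τ) ^ 2)⁻¹) with hk
  have hkm : Measurable k := by
    rw [hk]
    fun_prop
  set A : Fin 4 → ℝ → Set Sp := fun i e ↦
    {y | 0 ≤ e * (x i - y i) ∧ ‖x - y‖ ^ 2 ≤ 4 * (x i - y i) ^ 2} with hA
  have hAm : ∀ i e, MeasurableSet (A i e) := fun i e ↦
    (measurableSet_le (f := fun _ : Sp ↦ (0 : ℝ)) (by fun_prop) (by fun_prop)).inter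
      (measurableSet_le (f := fun y : Sp ↦ ‖x - y‖ ^ 2) (g := fun y : Sp ↦ 4 * (x i - y i) ^ 2)
        (by fun_prop) (by fun_prop))
  have hcover : ∀ y, k y ≤ ∑ i, ((A i 1).indicator k y + (A i (-1)).indicator k y) := by
    intro y
    obtain ⟨i, hi⟩ : ∃ i, ‖x - y‖ ^ 2 ≤ 4 * (x i - y i) ^ 2 := by
      by_contra! hcon
      have h1 : ‖x - y‖ ^ 2 = ∑ i, (x i - y i) ^ 2 := by
        rw [EuclideanSpace.norm_sq_eq]
        simp
      have h2 := Finset.sum_lt_sum_of_nonempty (s := Finset.univ) Finset.univ_nonempty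
        (fun i _ ↦ hcon i)
      rw [← Finset.mul_sum, ← h1] at h2
      simp at h2
    refine le_trans ?_ (Finset.single_le_sum (f := fun i ↦
      (A i 1).indicator k y + (A i (-1)).indicator k y) (fun _ _ ↦ zero_le) (Finset.mem_univ i))
    rcases le_total 0 (x i - y i) with h | h
    · have : y ∈ A i 1 := ⟨by linarith, hi⟩
      rw [Set.indicator_of_mem this]
      exact le_self_add
    · have : y ∈ A i (-1) := ⟨by linarith, hi⟩
      rw [Set.indicator_of_mem this]
      exact le_add_self
  have hpiece : ∀ i, ∀ e : ℝ, |e| = 1 → ∫⁻ y in cube μ a, (A i e).indicator k y ≤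
      ENNReal.ofReal (32 * Real.pi) * ENNReal.ofReal (μ⁻¹ ^ 3) := by
    intro i e he
    refine lintegral_cube_le hμ a (hkm.indicator (hAm i e)) i fun z ↦ ?_
    set w : ℝ → Sp := fun s ↦ WithLp.toLp 2 (i.insertNth (α := fun _ ↦ ℝ) s z) with hw
    have hwi : ∀ s, w s i = s := fun s ↦ by simp [hw]
    refine lintegral_indicator_inv_one_add_sq_le (w ⁻¹' A i e) (fun s ↦ ‖x - w s‖) τ ?_
    intro s hs s' hs'
    obtain ⟨hs1, hs2⟩ := hs
    obtain ⟨hs1', hs2'⟩ := hs'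
    rw [hwi] at hs1 hs2 hs1' hs2'
    have he2 : e ^ 2 = 1 := by rw [← sq_abs, he, one_pow]
    have := abs_sub_le_two_mul_abs_sub (b := ∑ j, (x (i.succAbove j) - z j) ^ 2) hs1 hs1'
      (norm_nonneg (x - w s)) (norm_nonneg (x - w s'))
      (by rw [mul_pow, he2, one_mul]; exact norm_sq_sub_insertNth x i s z)
      (by rw [mul_pow, he2, one_mul]; exact norm_sq_sub_insertNth x i s' z)
      (by rw [mul_pow, he2, one_mul]; exact hs2) (by rw [mul_pow, he2, one_mul]; exact hs2')
    rwa [← mul_sub, abs_mul, he, one_mul, sub_sub_sub_cancel_left, abs_sub_comm] at this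
  calc ∫⁻ y in cube μ a, k y
      ≤ ∫⁻ y in cube μ a, ∑ i, ((A i 1).indicator k y + (A i (-1)).indicator k y) :=
        lintegral_mono hcover
    _ = ∑ i, ((∫⁻ y in cube μ a, (A i 1).indicator k y) +
          ∫⁻ y in cube μ a, (A i (-1)).indicator k y) := by
        refine (lintegral_finsetSum _ fun i _ ↦
          (hkm.indicator (hAm i 1)).add (hkm.indicator (hAm i (-1)))).trans ?_
        exact Finset.sum_congr rfl fun i _ ↦ lintegral_add_left (hkm.indicator (hAm i 1)) _
    _ ≤ ∑ i : Fin 4, (ENNReal.ofReal (32 * Real.pi) * ENNReal.ofReal (μ⁻¹ ^ 3) +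
          ENNReal.ofReal (32 * Real.pi) * ENNReal.ofReal (μ⁻¹ ^ 3)) := by
        refine Finset.sum_le_sum fun i _ ↦
          add_le_add (hpiece i 1 (by simp)) (hpiece i (-1) (by simp))
    _ = _ := by
        have := Real.pi_pos
        rw [← ENNReal.ofReal_mul (by positivity), ← ENNReal.ofReal_add (by positivity)
          (by positivity), Finset.sum_const, Finset.card_univ, Fintype.card_fin,
          ← ENNReal.ofReal_nsmul]
        congr 1
        simp
        ring

lemma disjoint_cube {μ : ℝ} {a b : Fin 4 → ℤ} (hab : a ≠ b) : Disjoint (cube μ a) (cube μ b) := by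
  rw [Set.disjoint_left]
  intro x ha hb
  apply hab
  ext i
  have h1 := ha i
  have h2 := hb i
  have h3 : (a i : ℝ) < b i + 1 := by linarith
  have h4 : (b i : ℝ) < a i + 1 := by linarith
  norm_cast at h3 h4
  omega

lemma lintegral_poisson_lt_top : ∫⁻ x : Sp, ‖waveKernel 1 x‖ₑ < ∞ := by
  have h : Integrable (fun x : Sp ↦ poissonConst * (1 + ‖x‖ ^ 2) ^ (-(5 : ℝ) / 2)) := by
    refine (integrable_rpow_neg_one_add_norm_sq ?_).const_mul _
    simp
    norm_num
  refine lt_of_le_of_lt (lintegral_mono fun x ↦ ?_) h.hasFiniteIntegral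
  rw [← enorm_norm, norm_waveKernel_one, neg_div]

lemma norm_cexp_of_re_eq_zero {z : ℂ} (hz : z.re = 0) : ‖cexp z‖ = 1 := by
  rw [Complex.norm_exp, hz, Real.exp_zero]

/-- The frequency-space representative of the regularised half-wave at time `-t` issued from the
physical-space profile `e`. -/
def wavePacket (t : ℝ) (e : Sp → ℂ) (ξ : Sp) : ℂ :=
  ∫ x, e x * cexp (-(2 * Real.pi * I * (⟪x, ξ⟫ : ℝ)) - 2 * Real.pi * I * t * ‖ξ‖ - Real.pi * ‖ξ‖)

lemma norm_wavePacket_phase (t : ℝ) (x ξ : Sp) :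
    ‖cexp (-(2 * Real.pi * I * (⟪x, ξ⟫ : ℝ)) - 2 * Real.pi * I * t * ‖ξ‖ - Real.pi * ‖ξ‖)‖ =
      Real.exp (-Real.pi * ‖ξ‖) := by
  rw [Complex.norm_exp]
  congr 1
  simp

lemma norm_wavePacket_le (t : ℝ) (e : Sp → ℂ) (ξ : Sp) :
    ‖wavePacket t e ξ‖ ≤ (∫ x, ‖e x‖) * Real.exp (-Real.pi * ‖ξ‖) := by
  refine (norm_integral_le_integral_norm _).trans (le_of_eq ?_)
  simp only [norm_mul, norm_wavePacket_phase]
  rw [integral_mul_const]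

lemma memLp_exp_neg_mul_norm {c : ℝ} (hc : 0 < c) :
    MemLp (fun ξ : Sp ↦ Real.exp (-c * ‖ξ‖)) 2 := by
  rw [memLp_two_iff_integrable_sq_norm (Continuous.aestronglyMeasurable (by fun_prop))]
  refine (integrable_exp_neg_mul_norm (c := 2 * c) (by positivity)).congr
    (Filter.Eventually.of_forall fun ξ ↦ ?_)
  dsimp only
  rw [Real.norm_of_nonneg (Real.exp_pos _).le, ← Real.exp_nat_mul]
  congr 1
  push_cast
  ring

lemma memLp_wavePacket (t : ℝ) {e : Sp → ℂ} (he : StronglyMeasurable e) :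
    MemLp (wavePacket t e) 2 := by
  refine ((memLp_exp_neg_mul_norm Real.pi_pos).const_mul (∫ x, ‖e x‖)).mono' ?_
    (Filter.Eventually.of_forall fun ξ ↦ norm_wavePacket_le t e ξ)
  refine StronglyMeasurable.aestronglyMeasurable (StronglyMeasurable.integral_prod_right ?_)
  exact (he.comp_measurable measurable_snd).mul (Continuous.stronglyMeasurable (by fun_prop))

lemma conj_wavePacket (t : ℝ) (e : Sp → ℂ) (ξ : Sp) :
    (starRingEnd ℂ) (wavePacket t e ξ) =
      ∫ x, (starRingEnd ℂ) (e x) *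
        cexp (2 * Real.pi * I * (⟪x, ξ⟫ : ℝ) + 2 * Real.pi * I * t * ‖ξ‖ - Real.pi * ‖ξ‖) := by
  rw [wavePacket, ← integral_conj]
  congr 1 with x
  rw [map_mul, ← Complex.exp_conj]
  simp [map_ofNat (starRingEnd ℂ) 2]

lemma integral_conj_wavePacket_mul (t₁ t₂ : ℝ) {e₁ e₂ : Sp → ℂ} (h₁ : Integrable e₁)
    (h₂ : Integrable e₂) :
    ∫ ξ, (starRingEnd ℂ) (wavePacket t₁ e₁ ξ) * wavePacket t₂ e₂ ξ =
      ∫ p : Sp × Sp, (starRingEnd ℂ) (e₁ p.1) * e₂ p.2 *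
        waveKernel (1 - I * ((t₁ - t₂ : ℝ) : ℂ)) (p.1 - p.2) := by
  set z : ℂ := 1 - I * ((t₁ - t₂ : ℝ) : ℂ) with hz
  have hzre : z.re = 1 := by simp [hz]
  set E : Sp × Sp → ℂ := fun p ↦ (starRingEnd ℂ) (e₁ p.1) * e₂ p.2 with hE
  set G : Sp → Sp × Sp → ℂ := fun ξ p ↦ E p *
    cexp (2 * Real.pi * I * (⟪p.1 - p.2, ξ⟫ : ℝ) - 2 * Real.pi * z * ‖ξ‖) with hG
  have hEi : Integrable E := Integrable.mul_prod
    (LinearIsometryEquiv.integrable_comp_iff conjLIE |>.2 h₁) h₂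
  have h1 : ∀ ξ, (starRingEnd ℂ) (wavePacket t₁ e₁ ξ) * wavePacket t₂ e₂ ξ = ∫ p, G ξ p := by
    intro ξ
    rw [conj_wavePacket, wavePacket, ← integral_prod_mul, ← Measure.volume_eq_prod]
    congr 1 with p
    simp only [hG, hE]
    rw [mul_mul_mul_comm, ← Complex.exp_add, inner_sub_left, hz]
    congr 2
    push_cast
    ring
  have h_int : Integrable (Function.uncurry G) := by
    have hb : Integrable (fun q : Sp × (Sp × Sp) ↦ Real.exp (-(2 * Real.pi) * ‖q.1‖) * ‖E q.2‖) :=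
      Integrable.mul_prod (integrable_exp_neg_mul_norm (by positivity)) hEi.norm
    refine hb.mono' ?_ (Filter.Eventually.of_forall fun q ↦ ?_)
    · simp only [hG, Function.uncurry_def]
      exact (hEi.aestronglyMeasurable.comp_snd).mul
        (Continuous.aestronglyMeasurable (by fun_prop))
    · simp only [hG, Function.uncurry]
      rw [norm_mul, norm_cexp_waveKernel, hzre, mul_one, mul_comm]
  simp only [h1]
  rw [integral_integral_swap h_int]
  congr 1 with p
  simp only [hG]
  rw [integral_const_mul, waveKernel]

lemma enorm_integral_conj_wavePacket_mul_le (t₁ t₂ : ℝ) {e₁ e₂ : Sp → ℂ} (h₁ : Integrable e₁)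
    (h₂ : Integrable e₂) :
    ‖∫ ξ, (starRingEnd ℂ) (wavePacket t₁ e₁ ξ) * wavePacket t₂ e₂ ξ‖ₑ ≤
      ∫⁻ x, ∫⁻ y, ‖e₁ x‖ₑ * ‖e₂ y‖ₑ * ‖waveKernel (1 - I * ((t₁ - t₂ : ℝ) : ℂ)) (x - y)‖ₑ := by
  rw [integral_conj_wavePacket_mul t₁ t₂ h₁ h₂]
  refine (enorm_integral_le_lintegral_enorm _).trans ?_
  rw [Measure.volume_eq_prod]
  refine (lintegral_prod_le _).trans (le_of_eq ?_)
  simp [enorm_mul]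

lemma integral_conj_wavePacket_mul_fourier (t : ℝ) {e : Sp → ℂ} (he : Integrable e) {f : Sp → ℂ}
    (hf : Integrable (𝓕 f)) :
    ∫ ξ, (starRingEnd ℂ) (wavePacket t e ξ) * ((Real.exp (Real.pi * ‖ξ‖) : ℝ) * 𝓕 f ξ) =
      ∫ x, (starRingEnd ℂ) (e x) * halfWave f t x := by
  set G : Sp → Sp → ℂ := fun ξ x ↦ (starRingEnd ℂ) (e x) *
    (cexp (2 * Real.pi * I * ((t * ‖ξ‖ + ⟪x, ξ⟫ : ℝ) : ℂ)) * 𝓕 f ξ) with hG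
  have h1 : ∀ ξ, (starRingEnd ℂ) (wavePacket t e ξ) * ((Real.exp (Real.pi * ‖ξ‖) : ℝ) * 𝓕 f ξ) =
      ∫ x, G ξ x := by
    intro ξ
    rw [conj_wavePacket, ← integral_mul_const]
    congr 1 with x
    simp only [hG]
    rw [mul_assoc, ← mul_assoc (cexp _), Complex.ofReal_exp, ← Complex.exp_add]
    congr 3
    push_cast
    ring
  have hce : Integrable fun x ↦ (starRingEnd ℂ) (e x) :=
    LinearIsometryEquiv.integrable_comp_iff conjLIE |>.2 he
  have h_int : Integrable (Function.uncurry G) := by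
    have hb : Integrable (fun q : Sp × Sp ↦ ‖𝓕 f q.1‖ * ‖(starRingEnd ℂ) (e q.2)‖) :=
      Integrable.mul_prod hf.norm hce.norm
    refine hb.mono' ?_ (Filter.Eventually.of_forall fun q ↦ ?_)
    · simp only [hG, Function.uncurry_def]
      exact hce.aestronglyMeasurable.comp_snd.mul
        ((Continuous.aestronglyMeasurable (by fun_prop)).mul hf.aestronglyMeasurable.comp_fst)
    · simp only [hG, Function.uncurry]
      rw [norm_mul, norm_mul, norm_cexp_of_re_eq_zero (by simp), one_mul, mul_comm]
  simp only [h1]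
  rw [integral_integral_swap h_int]
  congr 1 with x
  simp only [hG]
  rw [integral_const_mul, halfWave]

lemma measurable_enorm_waveKernel (z : ℂ) : Measurable fun x ↦ ‖waveKernel z x‖ₑ := by
  refine (StronglyMeasurable.enorm (StronglyMeasurable.integral_prod_right ?_))
  exact Continuous.stronglyMeasurable (by fun_prop)

lemma ENNReal.mul_le_sq_add_sq (a b : ℝ≥0∞) : a * b ≤ a ^ 2 + b ^ 2 := by
  rcases le_total a b with h | h
  · calc a * b ≤ b * b := by gcongr
      _ = b ^ 2 := (sq b).symm
      _ ≤ _ := le_add_self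
  · calc a * b ≤ a * a := by gcongr
      _ = a ^ 2 := (sq a).symm
      _ ≤ _ := le_self_add

/-- Schur's test for a convolution kernel acting between functions supported on `B` and on `A`. -/
lemma lintegral_lintegral_schur_le {k : Sp → ℝ≥0∞} (hk : Measurable k) {a b : Sp → ℝ≥0∞}
    (ha : Measurable a) (hb : Measurable b) {A B : Set Sp} (hA : MeasurableSet A)
    (hB : MeasurableSet B) (haA : ∀ x ∉ A, a x = 0) (hbB : ∀ y ∉ B, b y = 0) {M : ℝ≥0∞}
    (h1 : ∀ x, ∫⁻ y in B, k (x - y) ≤ M) (h2 : ∀ y, ∫⁻ x in A, k (x - y) ≤ M) :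
    ∫⁻ x, ∫⁻ y, a x * b y * k (x - y) ≤ M * ((∫⁻ x, a x ^ 2) + ∫⁻ y, b y ^ 2) := by
  have hpt : ∀ x y, a x * b y * k (x - y) ≤
      a x ^ 2 * B.indicator (fun y ↦ k (x - y)) y +
        b y ^ 2 * A.indicator (fun x ↦ k (x - y)) x := by
    intro x y
    by_cases hx : x ∈ A
    · by_cases hy : y ∈ B
      · rw [Set.indicator_of_mem hx, Set.indicator_of_mem hy, ← add_mul]
        gcongr
        exact ENNReal.mul_le_sq_add_sq _ _
      · simp [hbB y hy]
    · simp [haA x hx]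
  have hkm : Measurable fun p : Sp × Sp ↦ k (p.1 - p.2) := hk.comp (by fun_prop)
  have hm1 : Measurable fun p : Sp × Sp ↦ a p.1 ^ 2 * B.indicator (fun y ↦ k (p.1 - y)) p.2 := by
    have : (fun p : Sp × Sp ↦ B.indicator (fun y ↦ k (p.1 - y)) p.2) =
        (Prod.snd ⁻¹' B).indicator fun p : Sp × Sp ↦ k (p.1 - p.2) := by
      rfl
    refine ((ha.comp measurable_fst).pow_const 2).mul ?_
    rw [this]
    exact hkm.indicator (measurable_snd hB)
  have hm2 : Measurable fun p : Sp × Sp ↦ b p.2 ^ 2 * A.indicator (fun x ↦ k (x - p.2)) p.1 := by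
    have : (fun p : Sp × Sp ↦ A.indicator (fun x ↦ k (x - p.2)) p.1) =
        (Prod.fst ⁻¹' A).indicator fun p : Sp × Sp ↦ k (p.1 - p.2) := by
      rfl
    refine ((hb.comp measurable_snd).pow_const 2).mul ?_
    rw [this]
    exact hkm.indicator (measurable_fst hA)
  have hkx : ∀ x, Measurable fun y ↦ B.indicator (fun y ↦ k (x - y)) y := fun x ↦
    (hk.comp (by fun_prop)).indicator hB
  have hky : ∀ y, Measurable fun x ↦ A.indicator (fun x ↦ k (x - y)) x := fun y ↦
    (hk.comp (by fun_prop)).indicator hA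
  calc ∫⁻ x, ∫⁻ y, a x * b y * k (x - y)
      ≤ ∫⁻ x, ∫⁻ y, (a x ^ 2 * B.indicator (fun y ↦ k (x - y)) y +
          b y ^ 2 * A.indicator (fun x ↦ k (x - y)) x) :=
        lintegral_mono fun x ↦ lintegral_mono fun y ↦ hpt x y
    _ = (∫⁻ x, ∫⁻ y, a x ^ 2 * B.indicator (fun y ↦ k (x - y)) y) +
          ∫⁻ x, ∫⁻ y, b y ^ 2 * A.indicator (fun x ↦ k (x - y)) x := by
        rw [← lintegral_add_left hm1.lintegral_prod_right']
        exact lintegral_congr fun x ↦ lintegral_add_left ((hkx x).const_mul _) _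
    _ = (∫⁻ x, a x ^ 2 * ∫⁻ y in B, k (x - y)) + ∫⁻ y, b y ^ 2 * ∫⁻ x in A, k (x - y) := by
        congr 1
        · refine lintegral_congr fun x ↦ ?_
          rw [lintegral_const_mul _ (hkx x), lintegral_indicator hB]
        · rw [lintegral_lintegral_swap hm2.aemeasurable]
          refine lintegral_congr fun y ↦ ?_
          rw [lintegral_const_mul _ (hky y), lintegral_indicator hA]
    _ ≤ (∫⁻ x, a x ^ 2 * M) + ∫⁻ y, b y ^ 2 * M := by
        gcongr with x y
        · exact h1 x
        · exact h2 y
    _ = _ := by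
        rw [lintegral_mul_const _ (ha.pow_const 2), lintegral_mul_const _ (hb.pow_const 2)]
        ring

/-- The wave packet as an element of `L²`. -/
def wavePacketLp (t : ℝ) {e : Sp → ℂ} (he : StronglyMeasurable e) : Lp ℂ 2 (volume : Measure Sp) :=
  (memLp_wavePacket t he).toLp

lemma inner_toLp_eq_re {u v : Sp → ℂ} (hu : MemLp u 2) (hv : MemLp v 2) :
    ⟪hu.toLp, hv.toLp⟫ = (∫ ξ, (starRingEnd ℂ) (u ξ) * v ξ).re := by
  have h_int : Integrable fun ξ ↦ (starRingEnd ℂ) (u ξ) * v ξ := by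
    have := hu.star.integrable_mul hv
    exact this
  rw [L2.inner_def]
  have : (∫ ξ, (starRingEnd ℂ) (u ξ) * v ξ).re = ∫ ξ, ((starRingEnd ℂ) (u ξ) * v ξ).re :=
    (integral_re h_int).symm
  rw [this]
  refine integral_congr_ae ?_
  filter_upwards [hu.coeFn_toLp, hv.coeFn_toLp] with ξ h1 h2
  rw [h1, h2, Complex.inner, mul_comm]

lemma ofReal_abs_inner_wavePacketLp_le (t₁ t₂ : ℝ) {e₁ e₂ : Sp → ℂ} (h₁ : StronglyMeasurable e₁)
    (h₂ : StronglyMeasurable e₂) (hi₁ : Integrable e₁) (hi₂ : Integrable e₂) :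
    ENNReal.ofReal |⟪wavePacketLp t₁ h₁, wavePacketLp t₂ h₂⟫| ≤
      ∫⁻ x, ∫⁻ y, ‖e₁ x‖ₑ * ‖e₂ y‖ₑ * ‖waveKernel (1 - I * ((t₁ - t₂ : ℝ) : ℂ)) (x - y)‖ₑ := by
  refine le_trans ?_ (enorm_integral_conj_wavePacket_mul_le t₁ t₂ hi₁ hi₂)
  rw [wavePacketLp, wavePacketLp, inner_toLp_eq_re, ← ofReal_norm]
  exact ENNReal.ofReal_le_ofReal (Complex.abs_re_le_norm _)

lemma sq_sum_eq_sum_sq {ι : Type*} (S : Finset ι) (g : ι → ℝ≥0∞)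
    (h : ∀ α ∈ S, ∀ β ∈ S, α ≠ β → g α = 0 ∨ g β = 0) : (∑ α ∈ S, g α) ^ 2 = ∑ α ∈ S, g α ^ 2 := by
  by_cases h0 : ∃ α ∈ S, g α ≠ 0
  · obtain ⟨α, hα, hg⟩ := h0
    have hz : ∀ β ∈ S, β ≠ α → g β = 0 := fun β hβ hne ↦
      (h α hα β hβ hne.symm).resolve_left hg
    rw [Finset.sum_eq_single_of_mem α hα hz, Finset.sum_eq_single_of_mem α hα]
    intro β hβ hne
    rw [hz β hβ hne, zero_pow two_ne_zero]
  · push Not at h0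
    rw [Finset.sum_eq_zero h0, Finset.sum_eq_zero fun α hα ↦ by rw [h0 α hα, zero_pow two_ne_zero],
      zero_pow two_ne_zero]

lemma volume_cube_lt_top {μ : ℝ} (hμ : 0 < μ) (a : Fin 4 → ℤ) : volume (cube μ a) < ∞ := by
  have : cube μ a = WithLp.ofLp ⁻¹'
      Set.pi Set.univ fun i ↦ Set.Ico ((a i : ℝ) / μ) (((a i : ℝ) + 1) / μ) := by
    ext x
    simp [cube, div_le_iff₀ hμ, lt_div_iff₀ hμ, mul_comm μ]
  rw [this, (PiLp.volume_preserving_ofLp (Fin 4)).measure_preimage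
    (MeasurableSet.univ_pi fun i ↦ measurableSet_Ico).nullMeasurableSet, Real.volume_pi_Ico]
  exact ENNReal.prod_lt_top fun i _ ↦ ENNReal.ofReal_lt_top

lemma cubeNorm_sq (μ : ℝ) (a : Fin 4 → ℤ) (h : Sp → ℂ) :
    cubeNorm μ a h ^ 2 = ∫⁻ x in cube μ a, ‖h x‖ₑ ^ 2 := by
  rw [cubeNorm, ← ENNReal.rpow_natCast, ← ENNReal.rpow_mul]
  norm_num
  rfl

lemma cubeNorm_ne_top {μ : ℝ} (hμ : 0 < μ) (a : Fin 4 → ℤ) {h : Sp → ℂ} {B : ℝ}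
    (hB : ∀ x, ‖h x‖ ≤ B) : cubeNorm μ a h ≠ ∞ := by
  have : cubeNorm μ a h ^ 2 < ∞ := by
    rw [cubeNorm_sq]
    calc ∫⁻ x in cube μ a, ‖h x‖ₑ ^ 2 ≤ ∫⁻ _ in cube μ a, ENNReal.ofReal B ^ 2 := by
          gcongr with x
          rw [← ofReal_norm]
          exact ENNReal.ofReal_le_ofReal (hB x)
      _ < ∞ := by
          rw [setLIntegral_const]
          exact ENNReal.mul_lt_top (by simp) (volume_cube_lt_top hμ a)
  exact fun h0 ↦ by simp [h0] at this

/-- The restriction of `h` to a cube, normalised in `L²`. -/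
def cubePiece (μ : ℝ) (a : Fin 4 → ℤ) (h : Sp → ℂ) : Sp → ℂ :=
  (cube μ a).indicator fun x ↦ h x / ((cubeNorm μ a h).toReal : ℂ)

lemma cubePiece_of_notMem {μ : ℝ} {a : Fin 4 → ℤ} (h : Sp → ℂ) {x : Sp} (hx : x ∉ cube μ a) :
    cubePiece μ a h x = 0 :=
  Set.indicator_of_notMem hx _

lemma stronglyMeasurable_cubePiece (μ : ℝ) (a : Fin 4 → ℤ) {h : Sp → ℂ}
    (hh : StronglyMeasurable h) : StronglyMeasurable (cubePiece μ a h) :=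
  (hh.div stronglyMeasurable_const).indicator (measurableSet_cube μ a)

lemma integrable_cubePiece {μ : ℝ} (hμ : 0 < μ) (a : Fin 4 → ℤ) {h : Sp → ℂ}
    (hh : StronglyMeasurable h) {B : ℝ} (hB : ∀ x, ‖h x‖ ≤ B) : Integrable (cubePiece μ a h) := by
  rw [cubePiece, integrable_indicator_iff (measurableSet_cube μ a)]
  exact (Measure.integrableOn_of_bounded (volume_cube_lt_top hμ a).ne hh.aestronglyMeasurable
    (Filter.Eventually.of_forall hB)).div_const _

lemma lintegral_enorm_cubePiece_sq_le {μ : ℝ} (hμ : 0 < μ) (a : Fin 4 → ℤ) {h : Sp → ℂ}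
    (hh : StronglyMeasurable h) {B : ℝ} (hB : ∀ x, ‖h x‖ ≤ B) :
    ∫⁻ x, ‖cubePiece μ a h x‖ₑ ^ 2 ≤ 1 := by
  have h1 : ∀ x, ‖cubePiece μ a h x‖ₑ ^ 2 =
      (cube μ a).indicator (fun x ↦ ‖((cubeNorm μ a h).toReal : ℂ)⁻¹‖ₑ ^ 2 * ‖h x‖ₑ ^ 2) x := by
    intro x
    by_cases hx : x ∈ cube μ a
    · rw [cubePiece, Set.indicator_of_mem hx, Set.indicator_of_mem hx, div_eq_inv_mul, enorm_mul,
        mul_pow]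
    · simp [cubePiece, hx]
  simp only [h1]
  rw [lintegral_indicator (measurableSet_cube μ a),
    lintegral_const_mul _ (hh.enorm.pow_const 2), ← cubeNorm_sq, ← mul_pow]
  refine pow_le_one₀ bot_le ?_
  by_cases h0 : cubeNorm μ a h = 0
  · simp [h0]
  have hne := cubeNorm_ne_top hμ a hB
  have hr : (cubeNorm μ a h).toReal ≠ 0 := ENNReal.toReal_ne_zero.2 ⟨h0, hne⟩
  rw [enorm_inv (by exact_mod_cast hr), ← ofReal_norm, Complex.norm_real,
    Real.norm_of_nonneg ENNReal.toReal_nonneg, ENNReal.ofReal_toReal hne]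
  exact ENNReal.inv_mul_le_one _

lemma integral_conj_cubePiece_mul (μ : ℝ) (a : Fin 4 → ℤ) {h : Sp → ℂ}
    (hh : StronglyMeasurable h) :
    ∫ x, (starRingEnd ℂ) (cubePiece μ a h x) * h x = ((cubeNorm μ a h).toReal : ℂ) := by
  have h1 : ∀ x, (starRingEnd ℂ) (cubePiece μ a h x) * h x =
      (cube μ a).indicator
        (fun x ↦ (((cubeNorm μ a h).toReal⁻¹ * ‖h x‖ ^ 2 : ℝ) : ℂ)) x := by
    intro x
    by_cases hx : x ∈ cube μ a
    · rw [cubePiece, Set.indicator_of_mem hx, Set.indicator_of_mem hx, map_div₀,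
        Complex.conj_ofReal,
        div_mul_eq_mul_div, Complex.conj_mul']
      push_cast
      ring
    · simp [cubePiece, hx]
  simp only [h1]
  rw [integral_indicator (measurableSet_cube μ a), integral_complex_ofReal, integral_const_mul,
    integral_eq_lintegral_of_nonneg_ae (Filter.Eventually.of_forall fun x ↦ by positivity)
      (by exact (hh.norm.pow 2).aestronglyMeasurable)]
  have h2 : ∀ x, ENNReal.ofReal (‖h x‖ ^ 2) = ‖h x‖ₑ ^ 2 := fun x ↦ by
    rw [ENNReal.ofReal_pow (norm_nonneg _), ofReal_norm]
  simp only [h2]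
  rw [← cubeNorm_sq, ENNReal.toReal_pow]
  congr 1
  by_cases h0 : (cubeNorm μ a h).toReal = 0
  · simp [h0]
  · field_simp

lemma stronglyMeasurable_halfWave {f : Sp → ℂ} (hf : StronglyMeasurable (𝓕 f)) (t : ℝ) :
    StronglyMeasurable (halfWave f t) := by
  refine StronglyMeasurable.integral_prod_right ?_
  exact (Continuous.stronglyMeasurable (by fun_prop)).mul (hf.comp_measurable measurable_snd)

lemma norm_halfWave_le (f : Sp → ℂ) (t : ℝ) (x : Sp) : ‖halfWave f t x‖ ≤ ∫ ξ, ‖𝓕 f ξ‖ := by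
  refine (norm_integral_le_integral_norm _).trans (le_of_eq ?_)
  congr 1 with ξ
  rw [norm_mul, norm_cexp_of_re_eq_zero (by simp), one_mul]

lemma ofReal_abs_inner_wavePacketLp_le_of_schur (t₁ t₂ : ℝ) {e₁ e₂ : Sp → ℂ}
    (h₁ : StronglyMeasurable e₁) (h₂ : StronglyMeasurable e₂) (hi₁ : Integrable e₁)
    (hi₂ : Integrable e₂) (hn₁ : ∫⁻ x, ‖e₁ x‖ₑ ^ 2 ≤ 1) (hn₂ : ∫⁻ x, ‖e₂ x‖ₑ ^ 2 ≤ 1)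
    {A B : Set Sp} (hA : MeasurableSet A) (hB : MeasurableSet B) (hA₁ : ∀ x ∉ A, e₁ x = 0)
    (hB₂ : ∀ y ∉ B, e₂ y = 0) {M : ℝ≥0∞}
    (hM₁ : ∀ x, ∫⁻ y in B, ‖waveKernel (1 - I * ((t₁ - t₂ : ℝ) : ℂ)) (x - y)‖ₑ ≤ M)
    (hM₂ : ∀ y, ∫⁻ x in A, ‖waveKernel (1 - I * ((t₁ - t₂ : ℝ) : ℂ)) (x - y)‖ₑ ≤ M) :
    ENNReal.ofReal |⟪wavePacketLp t₁ h₁, wavePacketLp t₂ h₂⟫| ≤ M * 2 := by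
  refine (ofReal_abs_inner_wavePacketLp_le t₁ t₂ h₁ h₂ hi₁ hi₂).trans ?_
  refine (lintegral_lintegral_schur_le (measurable_enorm_waveKernel _) h₁.enorm h₂.enorm hA hB
    (fun x hx ↦ by simp [hA₁ x hx]) (fun y hy ↦ by simp [hB₂ y hy]) hM₁ hM₂).trans ?_
  calc M * ((∫⁻ x, ‖e₁ x‖ₑ ^ 2) + ∫⁻ y, ‖e₂ y‖ₑ ^ 2) ≤ M * (1 + 1) := by gcongr
    _ = M * 2 := by rw [one_add_one_eq_two]

lemma lintegral_enorm_waveKernel_sub_left (z : ℂ) (x : Sp) :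
    ∫⁻ y, ‖waveKernel z (x - y)‖ₑ = ∫⁻ y, ‖waveKernel z y‖ₑ :=
  lintegral_sub_left_eq_self (fun y ↦ ‖waveKernel z y‖ₑ) x

lemma lintegral_enorm_waveKernel_sub_right (z : ℂ) (y : Sp) :
    ∫⁻ x, ‖waveKernel z (x - y)‖ₑ = ∫⁻ x, ‖waveKernel z x‖ₑ :=
  lintegral_sub_right_eq_self (fun x ↦ ‖waveKernel z x‖ₑ) y

lemma lintegral_lintegral_sum_mul_sum {ι : Type*} (S : Finset ι) {k : Sp → ℝ≥0∞}
    (hk : Measurable k) {g : ι → Sp → ℝ≥0∞} (hg : ∀ α, Measurable (g α)) :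
    ∫⁻ x, ∫⁻ y, (∑ α ∈ S, g α x) * (∑ β ∈ S, g β y) * k (x - y) =
      ∑ α ∈ S, ∑ β ∈ S, ∫⁻ x, ∫⁻ y, g α x * g β y * k (x - y) := by
  have hpm : ∀ α β, Measurable fun p : Sp × Sp ↦ g α p.1 * g β p.2 * k (p.1 - p.2) := fun α β ↦
    (((hg α).comp measurable_fst).mul ((hg β).comp measurable_snd)).mul (hk.comp (by fun_prop))
  have hy : ∀ α β x, Measurable fun y ↦ g α x * g β y * k (x - y) := fun α β x ↦
    (hpm α β).comp measurable_prodMk_left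
  have hx : ∀ α β, Measurable fun x ↦ ∫⁻ y, g α x * g β y * k (x - y) := fun α β ↦
    (hpm α β).lintegral_prod_right'
  have h1 : ∀ x y, (∑ α ∈ S, g α x) * (∑ β ∈ S, g β y) * k (x - y) =
      ∑ α ∈ S, ∑ β ∈ S, g α x * g β y * k (x - y) := by
    intro x y
    rw [Finset.sum_mul_sum]
    simp only [Finset.sum_mul]
  have h2 : ∀ x, ∫⁻ y, (∑ α ∈ S, g α x) * (∑ β ∈ S, g β y) * k (x - y) =
      ∑ α ∈ S, ∑ β ∈ S, ∫⁻ y, g α x * g β y * k (x - y) := by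
    intro x
    simp only [h1]
    rw [lintegral_finsetSum _ fun α _ ↦ Finset.measurable_fun_sum _ fun β _ ↦ hy α β x]
    exact Finset.sum_congr rfl fun α _ ↦ lintegral_finsetSum _ fun β _ ↦ hy α β x
  simp only [h2]
  rw [lintegral_finsetSum _ fun α _ ↦ Finset.measurable_fun_sum _ fun β _ ↦ hx α β]
  exact Finset.sum_congr rfl fun α _ ↦ lintegral_finsetSum _ fun β _ ↦ hx α β

/-- Almost orthogonality of simultaneous wave packets issued from disjointly supported profiles. -/
lemma sum_mul_abs_inner_wavePacketLp_le {ι : Type*} (S : Finset ι) {e : ι → Sp → ℂ}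
    (he : ∀ α, StronglyMeasurable (e α)) (hi : ∀ α, Integrable (e α))
    (hn : ∀ α, ∫⁻ x, ‖e α x‖ₑ ^ 2 ≤ 1) (hd : ∀ α β, α ≠ β → ∀ x, e α x = 0 ∨ e β x = 0)
    (t : ℝ) (c : ι → ℝ) (hc : ∀ α, 0 ≤ c α) :
    ∑ α ∈ S, ∑ β ∈ S, c α * c β * |⟪wavePacketLp t (he α), wavePacketLp t (he β)⟫| ≤
      2 * (∫⁻ x, ‖waveKernel 1 x‖ₑ).toReal * ∑ α ∈ S, c α ^ 2 := by
  set k : Sp → ℝ≥0∞ := fun x ↦ ‖waveKernel 1 x‖ₑ with hk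
  have hkm : Measurable k := measurable_enorm_waveKernel 1
  set E : Sp → ℝ≥0∞ := fun x ↦ ∑ α ∈ S, ENNReal.ofReal (c α) * ‖e α x‖ₑ with hE
  have hEm : Measurable E := Finset.measurable_fun_sum _ fun α _ ↦ (he α).enorm.const_mul _
  have hE2 : ∫⁻ x, E x ^ 2 ≤ ENNReal.ofReal (∑ α ∈ S, c α ^ 2) := by
    have h1 : ∀ x, E x ^ 2 = ∑ α ∈ S, ENNReal.ofReal (c α) ^ 2 * ‖e α x‖ₑ ^ 2 := by
      intro x
      simp only [hE]
      rw [sq_sum_eq_sum_sq]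
      · simp only [mul_pow]
      · intro α _ β _ hne
        rcases hd α β hne x with h0 | h0
        · left; simp [h0]
        · right; simp [h0]
    simp only [h1]
    rw [lintegral_finsetSum _ fun α _ ↦ ((he α).enorm.pow_const 2).const_mul _,
      ENNReal.ofReal_sum_of_nonneg fun α _ ↦ sq_nonneg _]
    refine Finset.sum_le_sum fun α _ ↦ ?_
    rw [lintegral_const_mul _ ((he α).enorm.pow_const 2), ENNReal.ofReal_pow (hc α)]
    exact mul_le_of_le_one_right' (hn α)
  have hpair : ∀ α β, ENNReal.ofReal |⟪wavePacketLp t (he α), wavePacketLp t (he β)⟫| ≤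
      ∫⁻ x, ∫⁻ y, ‖e α x‖ₑ * ‖e β y‖ₑ * k (x - y) := by
    intro α β
    have := ofReal_abs_inner_wavePacketLp_le t t (he α) (he β) (hi α) (hi β)
    simpa [hk] using this
  have hfin : ∀ α β, ENNReal.ofReal (c α) * ENNReal.ofReal (c β) ≠ ∞ := fun α β ↦
    ENNReal.mul_ne_top ENNReal.ofReal_ne_top ENNReal.ofReal_ne_top
  have hsum : ∑ α ∈ S, ∑ β ∈ S, ENNReal.ofReal (c α) * ENNReal.ofReal (c β) *
      ∫⁻ x, ∫⁻ y, ‖e α x‖ₑ * ‖e β y‖ₑ * k (x - y) = ∫⁻ x, ∫⁻ y, E x * E y * k (x - y) := by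
    rw [lintegral_lintegral_sum_mul_sum S hkm fun α ↦ (he α).enorm.const_mul _]
    refine Finset.sum_congr rfl fun α _ ↦ Finset.sum_congr rfl fun β _ ↦ ?_
    rw [← lintegral_const_mul' _ _ (hfin α β)]
    refine lintegral_congr fun x ↦ ?_
    rw [← lintegral_const_mul' _ _ (hfin α β)]
    refine lintegral_congr fun y ↦ ?_
    ring
  have hκ : (∫⁻ x, k x) ≠ ∞ := lintegral_poisson_lt_top.ne
  have hc2 : 0 ≤ ∑ α ∈ S, c α ^ 2 := Finset.sum_nonneg fun α _ ↦ sq_nonneg _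
  rw [← ENNReal.ofReal_le_ofReal_iff (by positivity)]
  calc ENNReal.ofReal (∑ α ∈ S, ∑ β ∈ S,
        c α * c β * |⟪wavePacketLp t (he α), wavePacketLp t (he β)⟫|)
      = ∑ α ∈ S, ∑ β ∈ S, ENNReal.ofReal (c α) * ENNReal.ofReal (c β) *
          ENNReal.ofReal |⟪wavePacketLp t (he α), wavePacketLp t (he β)⟫| := by
        have hnn : ∀ α β, 0 ≤ c α * c β * |⟪wavePacketLp t (he α), wavePacketLp t (he β)⟫| :=
          fun α β ↦ mul_nonneg (mul_nonneg (hc α) (hc β)) (abs_nonneg _)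
        rw [ENNReal.ofReal_sum_of_nonneg fun α _ ↦ Finset.sum_nonneg fun β _ ↦ hnn α β]
        refine Finset.sum_congr rfl fun α _ ↦ ?_
        rw [ENNReal.ofReal_sum_of_nonneg fun β _ ↦ hnn α β]
        refine Finset.sum_congr rfl fun β _ ↦ ?_
        rw [ENNReal.ofReal_mul (mul_nonneg (hc α) (hc β)), ENNReal.ofReal_mul (hc α)]
    _ ≤ ∫⁻ x, ∫⁻ y, E x * E y * k (x - y) := by
        rw [← hsum]
        gcongr with α _ β _
        exact hpair α β
    _ ≤ (∫⁻ x, k x) * ((∫⁻ x, E x ^ 2) + ∫⁻ y, E y ^ 2) := by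
        refine lintegral_lintegral_schur_le hkm hEm hEm MeasurableSet.univ MeasurableSet.univ
          (by simp) (by simp) (fun x ↦ ?_) fun y ↦ ?_
        · rw [setLIntegral_univ]
          exact (lintegral_enorm_waveKernel_sub_left 1 x).le
        · rw [setLIntegral_univ]
          exact (lintegral_enorm_waveKernel_sub_right 1 y).le
    _ ≤ (∫⁻ x, k x) * (ENNReal.ofReal (∑ α ∈ S, c α ^ 2) +
          ENNReal.ofReal (∑ α ∈ S, c α ^ 2)) := by
        gcongr
    _ = _ := by
        rw [ENNReal.ofReal_mul (by positivity), ENNReal.ofReal_mul two_pos.le,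
          ENNReal.ofReal_toReal hκ, ENNReal.ofReal_ofNat]
        ring

lemma lintegral_cube_enorm_waveKernel_le {μ : ℝ} (hμ : 0 < μ) (a : Fin 4 → ℤ) {s : ℝ}
    (hs : 1 ≤ |s|) (x : Sp) :
    ∫⁻ y in cube μ a, ‖waveKernel (1 - I * s) (x - y)‖ₑ ≤
      ENNReal.ofReal (512 * Real.pi * poissonConst * |s| ^ (-(3 / 2) : ℝ) * μ⁻¹ ^ 3) := by
  have hC : 0 ≤ 2 * poissonConst * |s| ^ (-(3 / 2) : ℝ) := by
    have := poissonConst_pos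
    positivity
  calc ∫⁻ y in cube μ a, ‖waveKernel (1 - I * s) (x - y)‖ₑ
      ≤ ∫⁻ y in cube μ a, ENNReal.ofReal (2 * poissonConst * |s| ^ (-(3 / 2) : ℝ)) *
          ENNReal.ofReal ((1 + (‖x - y‖ - |s|) ^ 2)⁻¹) := by
        gcongr with y
        rw [← ofReal_norm, ← ENNReal.ofReal_mul hC]
        exact ENNReal.ofReal_le_ofReal (norm_waveKernel_le hs _)
    _ = ENNReal.ofReal (2 * poissonConst * |s| ^ (-(3 / 2) : ℝ)) *
          ∫⁻ y in cube μ a, ENNReal.ofReal ((1 + (‖x - y‖ - |s|) ^ 2)⁻¹) :=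
        lintegral_const_mul' _ _ ENNReal.ofReal_ne_top
    _ ≤ ENNReal.ofReal (2 * poissonConst * |s| ^ (-(3 / 2) : ℝ)) *
          ENNReal.ofReal (256 * Real.pi * μ⁻¹ ^ 3) := by
        gcongr
        exact lintegral_cube_shell_le hμ a x |s|
    _ = _ := by
        rw [← ENNReal.ofReal_mul hC]
        congr 1
        ring

lemma waveKernel_neg (z : ℂ) (x : Sp) : waveKernel z (-x) = waveKernel z x := by
  rw [waveKernel, ← integral_neg_eq_self]
  simp [waveKernel]

lemma rpow_neg_le_pow_timeScale {n m : ℤ} (h : n ≠ m) :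
    |((n - m : ℤ) : ℝ)| ^ (-(3 / 2) : ℝ) ≤ (1 / 4096) ^ timeScale n m := by
  have h0 : (n - m).natAbs ≠ 0 := by
    rw [Int.natAbs_ne_zero]
    exact sub_ne_zero.2 h
  have h1 : (256 : ℝ) ^ timeScale n m ≤ |((n - m : ℤ) : ℝ)| := by
    rw [← Int.cast_abs, Int.abs_eq_natAbs]
    exact_mod_cast Nat.pow_log_le_self 256 h0
  calc |((n - m : ℤ) : ℝ)| ^ (-(3 / 2) : ℝ) ≤ ((256 : ℝ) ^ timeScale n m) ^ (-(3 / 2) : ℝ) :=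
        Real.rpow_le_rpow_of_nonpos (by positivity) h1 (by norm_num)
    _ = _ := by
        rw [← Real.rpow_natCast, ← Real.rpow_mul (by norm_num), mul_comm,
          Real.rpow_mul (by norm_num),
          Real.rpow_natCast]
        congr 1
        rw [show (256 : ℝ) = 16 ^ (2 : ℝ) by norm_num, ← Real.rpow_mul (by norm_num)]
        norm_num

/-- Almost orthogonality of wave packets at times in an arithmetic progression of step `μ⁻²`. -/
lemma abs_inner_wavePacketLp_le {μ : ℝ} (hμ : 0 < μ) (hμ1 : μ ≤ 1) (τ : ℝ) (n m : ℤ)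
    (a b : Fin 4 → ℤ) {e₁ e₂ : Sp → ℂ} (h₁ : StronglyMeasurable e₁) (h₂ : StronglyMeasurable e₂)
    (hi₁ : Integrable e₁) (hi₂ : Integrable e₂) (hn₁ : ∫⁻ x, ‖e₁ x‖ₑ ^ 2 ≤ 1)
    (hn₂ : ∫⁻ x, ‖e₂ x‖ₑ ^ 2 ≤ 1) (hA₁ : ∀ x ∉ cube μ a, e₁ x = 0)
    (hB₂ : ∀ y ∉ cube μ b, e₂ y = 0) :
    |⟪wavePacketLp (τ + n * μ⁻¹ ^ 2) h₁, wavePacketLp (τ + m * μ⁻¹ ^ 2) h₂⟫| ≤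
      (2 * (∫⁻ x, ‖waveKernel 1 x‖ₑ).toReal + 1024 * Real.pi * poissonConst) *
        (1 / 4096) ^ timeScale n m := by
  have hP := poissonConst_pos
  rcases eq_or_ne n m with rfl | hne
  · have hκ : (∫⁻ x : Sp, ‖waveKernel 1 x‖ₑ) ≠ ∞ := lintegral_poisson_lt_top.ne
    have := ofReal_abs_inner_wavePacketLp_le_of_schur (τ + n * μ⁻¹ ^ 2) (τ + n * μ⁻¹ ^ 2) h₁ h₂
      hi₁ hi₂ hn₁ hn₂ MeasurableSet.univ MeasurableSet.univ (by simp) (by simp)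
      (M := ∫⁻ x, ‖waveKernel 1 x‖ₑ)
      (fun x ↦ by simpa using (lintegral_enorm_waveKernel_sub_left 1 x).le)
      (fun y ↦ by simpa using (lintegral_enorm_waveKernel_sub_right 1 y).le)
    rw [ENNReal.ofReal_le_iff_le_toReal (ENNReal.mul_ne_top hκ (by simp)), ENNReal.toReal_mul,
      ENNReal.toReal_ofNat] at this
    refine this.trans ?_
    simp only [timeScale, sub_self, Int.natAbs_zero, Nat.log_zero_right, pow_zero, mul_one]
    rw [mul_comm]
    exact le_add_of_nonneg_right (by positivity)
  · set s : ℝ := (τ + n * μ⁻¹ ^ 2) - (τ + m * μ⁻¹ ^ 2) with hs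
    have hs' : s = ((n - m : ℤ) : ℝ) * μ⁻¹ ^ 2 := by
      rw [hs]
      push_cast
      ring
    have hi1 : 1 ≤ μ⁻¹ := (one_le_inv₀ hμ).2 hμ1
    have hnm : 1 ≤ |((n - m : ℤ) : ℝ)| := by
      rw [← Int.cast_abs]
      exact_mod_cast Int.one_le_abs (sub_ne_zero.2 hne)
    have hsabs : |s| = |((n - m : ℤ) : ℝ)| * μ⁻¹ ^ 2 := by
      rw [hs', abs_mul, abs_of_nonneg (sq_nonneg μ⁻¹)]
    have hs1 : 1 ≤ |s| := by
      rw [hsabs]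
      exact one_le_mul_of_one_le_of_one_le hnm (one_le_pow₀ hi1)
    have hscale : |s| ^ (-(3 / 2) : ℝ) * μ⁻¹ ^ 3 = |((n - m : ℤ) : ℝ)| ^ (-(3 / 2) : ℝ) := by
      rw [hsabs, Real.mul_rpow (abs_nonneg _) (by positivity), mul_assoc, ← Real.rpow_natCast μ⁻¹ 2,
        ← Real.rpow_mul (by positivity), ← Real.rpow_natCast μ⁻¹ 3,
        ← Real.rpow_add (by positivity)]
      norm_num
    have hM := fun c x ↦ lintegral_cube_enorm_waveKernel_le hμ c hs1 x
    have := ofReal_abs_inner_wavePacketLp_le_of_schur (τ + n * μ⁻¹ ^ 2) (τ + m * μ⁻¹ ^ 2) h₁ h₂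
      hi₁ hi₂ hn₁ hn₂ (measurableSet_cube μ a) (measurableSet_cube μ b) hA₁ hB₂
      (fun x ↦ hM b x) (fun y ↦ by
        refine le_trans (le_of_eq ?_) (hM a y)
        refine lintegral_congr fun x ↦ ?_
        rw [← waveKernel_neg, neg_sub])
    rw [ENNReal.ofReal_le_iff_le_toReal (by finiteness), ENNReal.toReal_mul,
      ENNReal.toReal_ofNat, ENNReal.toReal_ofReal (by positivity)] at this
    refine this.trans ?_
    calc 512 * Real.pi * poissonConst * |s| ^ (-(3 / 2) : ℝ) * μ⁻¹ ^ 3 * 2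
        = 1024 * Real.pi * poissonConst * |((n - m : ℤ) : ℝ)| ^ (-(3 / 2) : ℝ) := by
          rw [← hscale]
          ring
      _ ≤ _ := by
          gcongr
          · exact le_add_of_nonneg_left (by positivity)
          · exact rpow_neg_le_pow_timeScale hne

lemma UnitFrequency.norm_exp_mul_fourier_le {f : Sp → ℂ} (hf : UnitFrequency f) (ξ : Sp) :
    ‖(Real.exp (Real.pi * ‖ξ‖) : ℝ) * 𝓕 f ξ‖ ≤ Real.exp (2 * Real.pi) * ‖𝓕 f ξ‖ := by
  by_cases h0 : 𝓕 f ξ = 0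
  · simp [h0]
  · rw [norm_mul, Complex.norm_real, Real.norm_of_nonneg (Real.exp_pos _).le]
    refine mul_le_mul_of_nonneg_right (Real.exp_le_exp.2 ?_) (norm_nonneg _)
    nlinarith [(hf ξ h0).2, Real.pi_pos]

lemma UnitFrequency.memLp_exp_mul_fourier {f : SchwartzMap Sp ℂ} (hf : UnitFrequency f) :
    MemLp (fun ξ ↦ (Real.exp (Real.pi * ‖ξ‖) : ℝ) * 𝓕 (f : Sp → ℂ) ξ) 2 := by
  have h1 : MemLp (𝓕 (f : Sp → ℂ)) 2 := by
    rw [← SchwartzMap.fourier_coe]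
    exact (𝓕 f).memLp 2
  refine h1.of_le_mul (c := Real.exp (2 * Real.pi)) ?_
    (Filter.Eventually.of_forall hf.norm_exp_mul_fourier_le)
  exact (Continuous.aestronglyMeasurable (by fun_prop)).mul h1.aestronglyMeasurable

lemma UnitFrequency.norm_toLp_exp_mul_fourier_le {f : SchwartzMap Sp ℂ} (hf : UnitFrequency f) :
    ‖hf.memLp_exp_mul_fourier.toLp‖ ≤ Real.exp (2 * Real.pi) * (eLpNorm f 2 volume).toReal := by
  have h : ‖hf.memLp_exp_mul_fourier.toLp‖ ≤ Real.exp (2 * Real.pi) * ‖(𝓕 f).toLp 2‖ := by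
    refine Lp.norm_le_mul_norm_of_ae_le_mul ?_
    filter_upwards [hf.memLp_exp_mul_fourier.coeFn_toLp, (𝓕 f).coeFn_toLp 2] with ξ h1 h2
    rw [h1, h2, SchwartzMap.fourier_coe]
    exact hf.norm_exp_mul_fourier_le ξ
  rwa [SchwartzMap.norm_fourier_toL2_eq, SchwartzMap.norm_toLp] at h

/-- The constant in the discretised two-scale Strichartz estimate. -/
def gramConst : ℝ :=
  2 * (∫⁻ x, ‖waveKernel 1 x‖ₑ).toReal + 1024 * Real.pi * poissonConst

lemma gramConst_pos : 0 < gramConst := by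
  have := poissonConst_pos
  unfold gramConst
  positivity

lemma UnitFrequency.inner_toLp_wavePacketLp {f : SchwartzMap Sp ℂ} (hf : UnitFrequency f) (t : ℝ)
    {e : Sp → ℂ} (he : StronglyMeasurable e) (hi : Integrable e) :
    ⟪hf.memLp_exp_mul_fourier.toLp, wavePacketLp t he⟫ =
      (∫ x, (starRingEnd ℂ) (e x) * halfWave f t x).re := by
  have hF : Integrable (𝓕 (f : Sp → ℂ)) := by
    rw [← SchwartzMap.fourier_coe]
    exact (𝓕 f).integrable
  rw [real_inner_comm, wavePacketLp, inner_toLp_eq_re, integral_conj_wavePacket_mul_fourier t hi hF]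

lemma UnitFrequency.sum_sum_toReal_cubeNorm_le {f : SchwartzMap Sp ℂ} (hf : UnitFrequency f)
    {μ : ℝ} (hμ : 0 < μ) (hμ1 : μ ≤ 1) (τ : ℝ) (N : Finset ℤ) (S : Finset (Fin 4 → ℤ)) :
    ∑ n ∈ N, (∑ α ∈ S,
        (cubeNorm μ α (halfWave f (τ + n * μ⁻¹ ^ 2))).toReal ^ 6) ^ (1 / 3 : ℝ) ≤
      2 ^ 41 * gramConst * (Real.exp (2 * Real.pi) * (eLpNorm f 2 volume).toReal) ^ 2 := by
  have hFc : Continuous (𝓕 (f : Sp → ℂ)) := by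
    rw [← SchwartzMap.fourier_coe]
    exact (𝓕 f).continuous
  set u : ℤ → Sp → ℂ := fun n ↦ halfWave f (τ + n * μ⁻¹ ^ 2) with hu
  have hum : ∀ n, StronglyMeasurable (u n) := fun n ↦
    stronglyMeasurable_halfWave hFc.stronglyMeasurable _
  have hub : ∀ n x, ‖u n x‖ ≤ ∫ ξ, ‖𝓕 (f : Sp → ℂ) ξ‖ := fun n x ↦ norm_halfWave_le _ _ _
  set e : ℤ → (Fin 4 → ℤ) → Sp → ℂ := fun n α ↦ cubePiece μ α (u n) with he
  have hem : ∀ n α, StronglyMeasurable (e n α) := fun n α ↦ stronglyMeasurable_cubePiece μ α (hum n)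
  have hei : ∀ n α, Integrable (e n α) := fun n α ↦ integrable_cubePiece hμ α (hum n) (hub n)
  have hen : ∀ n α, ∫⁻ x, ‖e n α x‖ₑ ^ 2 ≤ 1 := fun n α ↦
    lintegral_enorm_cubePiece_sq_le hμ α (hum n) (hub n)
  have hes : ∀ n α, ∀ x ∉ cube μ α, e n α x = 0 := fun n α x hx ↦ cubePiece_of_notMem _ hx
  set v : ℤ → (Fin 4 → ℤ) → ℝ := fun n α ↦ (cubeNorm μ α (u n)).toReal with hv
  have hv0 : ∀ n α, 0 ≤ v n α := fun n α ↦ ENNReal.toReal_nonneg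
  have hs0 : ∀ n, 0 ≤ ∑ α ∈ S, v n α ^ 6 := fun n ↦
    Finset.sum_nonneg fun α _ ↦ pow_nonneg (hv0 n α) 6
  have key := sum_sq_le_of_gram S N (fun n α ↦ wavePacketLp (τ + n * μ⁻¹ ^ 2) (hem n α))
    gramConst_pos.le
    (fun n c hc ↦ by
      refine (sum_mul_abs_inner_wavePacketLp_le S (hem n) (hei n) (hen n) ?_ _ c hc).trans ?_
      · intro α β hne x
        by_cases hx : x ∈ cube μ α
        · exact Or.inr (hes n β x (Set.disjoint_left.1 (disjoint_cube hne) hx))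
        · exact Or.inl (hes n α x hx)
      · have := poissonConst_pos
        exact mul_le_mul_of_nonneg_right (le_add_of_nonneg_right (by positivity))
          (Finset.sum_nonneg fun α _ ↦ sq_nonneg _))
    (fun n m α β ↦ abs_inner_wavePacketLp_le hμ hμ1 τ n m α β (hem n α) (hem m β) (hei n α)
      (hei m β) (hen n α) (hen m β) (hes n α) (hes m β))
    v (fun n α ↦ hv0 n α) (fun n ↦ (∑ α ∈ S, v n α ^ 6) ^ (1 / 6 : ℝ))
    (fun n ↦ Real.rpow_nonneg (hs0 n) _)
    (fun n ↦ by
      rw [← Real.rpow_natCast, ← Real.rpow_mul (hs0 n)]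
      norm_num)
    hf.memLp_exp_mul_fourier.toLp
    (fun n α ↦ by
      rw [hf.inner_toLp_wavePacketLp _ (hem n α) (hei n α)]
      have := integral_conj_cubePiece_mul μ α (hum n)
      simp only [he, hu] at this ⊢
      rw [this, Complex.ofReal_re])
  calc ∑ n ∈ N, (∑ α ∈ S, v n α ^ 6) ^ (1 / 3 : ℝ)
      = ∑ n ∈ N, ((∑ α ∈ S, v n α ^ 6) ^ (1 / 6 : ℝ)) ^ 2 := by
        refine Finset.sum_congr rfl fun n _ ↦ ?_
        rw [← Real.rpow_natCast _ 2, ← Real.rpow_mul (hs0 n)]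
        norm_num
    _ ≤ _ := by
        refine key.trans ?_
        have := gramConst_pos
        gcongr
        exact hf.norm_toLp_exp_mul_fourier_le

lemma sum_lintegral_le_lintegral_sum {α ι : Type*} [MeasurableSpace α] {ν : Measure α}
    (N : Finset ι) (G : ι → α → ℝ≥0∞) :
    ∑ n ∈ N, ∫⁻ x, G n x ∂ν ≤ ∫⁻ x, ∑ n ∈ N, G n x ∂ν := by
  classical
  induction N using Finset.induction_on with
  | empty => simp
  | insert n N hn ih =>
    simp only [Finset.sum_insert hn]
    exact (add_le_add_right ih _).trans (le_lintegral_add _ _)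

lemma lintegral_le_mul_of_sum_translates_le {F : ℝ → ℝ≥0∞} {T : ℝ} (hT : 0 < T) {K : ℝ≥0∞}
    (h : ∀ τ, ∀ N : Finset ℤ, ∑ n ∈ N, F (τ + n * T) ≤ K) :
    ∫⁻ t, F t ≤ K * ENNReal.ofReal T := by
  have hset : ∀ n : ℤ, ∫⁻ t in Set.Ico (n • T) ((n + 1) • T), F t =
      ∫⁻ τ in Set.Ico 0 T, F (τ + n * T) := by
    intro n
    have hpre : Set.Ico 0 T = (fun τ : ℝ ↦ τ + n * T) ⁻¹' Set.Ico (n • T) ((n + 1) • T) := by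
      simp [add_mul]
    rw [hpre, (measurePreserving_add_right volume ((n : ℝ) * T)).setLIntegral_comp_preimage_emb
      (measurableEmbedding_addRight _)]
  calc ∫⁻ t, F t = ∫⁻ t in ⋃ n : ℤ, Set.Ico (n • T) ((n + 1) • T), F t := by
        rw [iUnion_Ico_zsmul hT, setLIntegral_univ]
    _ ≤ ∑' n : ℤ, ∫⁻ t in Set.Ico (n • T) ((n + 1) • T), F t := lintegral_iUnion_le _ _
    _ = ∑' n : ℤ, ∫⁻ τ in Set.Ico 0 T, F (τ + n * T) := by simp only [hset]
    _ ≤ K * ENNReal.ofReal T := by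
        rw [ENNReal.tsum_eq_iSup_sum]
        refine iSup_le fun N ↦ (sum_lintegral_le_lintegral_sum N _).trans ?_
        calc ∫⁻ τ in Set.Ico 0 T, ∑ n ∈ N, F (τ + n * T) ≤ ∫⁻ _ in Set.Ico 0 T, K :=
              lintegral_mono fun τ ↦ h τ N
          _ = K * ENNReal.ofReal T := by simp

lemma ENNReal.tsum_rpow_rpow_le {ι : Type*} (a : ι → ℝ≥0∞) {r : ℝ} (hr : 6 ≤ r) :
    (∑' i, a i ^ r) ^ (2 / r) ≤ (∑' i, a i ^ 6) ^ (1 / 3 : ℝ) := by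
  set s := ∑' i, a i ^ 6 with hs
  have hr0 : 0 ≤ r / 6 - 1 := by linarith
  have h1 : ∑' i, a i ^ r ≤ s ^ (r / 6) := by
    calc ∑' i, a i ^ r ≤ ∑' i, a i ^ 6 * s ^ (r / 6 - 1) := by
          refine ENNReal.tsum_le_tsum fun i ↦ ?_
          calc a i ^ r = (a i ^ 6) ^ (1 + (r / 6 - 1)) := by
                rw [← ENNReal.rpow_natCast, ← ENNReal.rpow_mul]
                congr 1
                push_cast
                ring
            _ = a i ^ 6 * (a i ^ 6) ^ (r / 6 - 1) := by
                rw [ENNReal.rpow_add_of_nonneg _ _ zero_le_one hr0, ENNReal.rpow_one]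
            _ ≤ a i ^ 6 * s ^ (r / 6 - 1) := by
                gcongr
                exact ENNReal.le_tsum (f := fun i ↦ a i ^ 6) i
      _ = s ^ (1 : ℝ) * s ^ (r / 6 - 1) := by rw [ENNReal.tsum_mul_right, ENNReal.rpow_one]
      _ = s ^ (r / 6) := by
          rw [← ENNReal.rpow_add_of_nonneg _ _ zero_le_one hr0]
          congr 1
          ring
  calc (∑' i, a i ^ r) ^ (2 / r) ≤ (s ^ (r / 6)) ^ (2 / r) := by gcongr
    _ = s ^ (1 / 3 : ℝ) := by
        rw [← ENNReal.rpow_mul]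
        congr 1
        field_simp
        norm_num

lemma ENNReal.ofReal_sum_sum_toReal_pow_rpow {ι κ : Type*} (N : Finset ι) (S : Finset κ)
    {x : ι → κ → ℝ≥0∞} (hx : ∀ n α, x n α ≠ ∞) :
    ENNReal.ofReal (∑ n ∈ N, (∑ α ∈ S, (x n α).toReal ^ 6) ^ (1 / 3 : ℝ)) =
      ∑ n ∈ N, (∑ α ∈ S, x n α ^ 6) ^ (1 / 3 : ℝ) := by
  rw [ENNReal.ofReal_sum_of_nonneg fun n _ ↦ by positivity]
  refine Finset.sum_congr rfl fun n _ ↦ ?_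
  rw [← ENNReal.ofReal_rpow_of_nonneg (by positivity) (by norm_num),
    ENNReal.ofReal_sum_of_nonneg fun α _ ↦ by positivity]
  congr 1
  refine Finset.sum_congr rfl fun α _ ↦ ?_
  rw [ENNReal.ofReal_pow ENNReal.toReal_nonneg, ENNReal.ofReal_toReal (hx n α)]

lemma UnitFrequency.sum_sum_cubeNorm_le {f : SchwartzMap Sp ℂ} (hf : UnitFrequency f)
    {μ : ℝ} (hμ : 0 < μ) (hμ1 : μ ≤ 1) (τ : ℝ) (N : Finset ℤ) (S : Finset (Fin 4 → ℤ)) :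
    ∑ n ∈ N, (∑ α ∈ S, cubeNorm μ α (halfWave f (τ + n * μ⁻¹ ^ 2)) ^ 6) ^ (1 / 3 : ℝ) ≤
      ENNReal.ofReal (2 ^ 41 * gramConst * Real.exp (2 * Real.pi) ^ 2) *
        eLpNorm f 2 volume ^ 2 := by
  have hD : 0 ≤ 2 ^ 41 * gramConst * Real.exp (2 * Real.pi) ^ 2 := by
    have := gramConst_pos
    positivity
  have hf2 : eLpNorm f 2 volume ≠ ∞ := (f.memLp 2 volume).eLpNorm_ne_top
  have hK : ENNReal.ofReal
      (2 ^ 41 * gramConst * (Real.exp (2 * Real.pi) * (eLpNorm f 2 volume).toReal) ^ 2) =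
      ENNReal.ofReal (2 ^ 41 * gramConst * Real.exp (2 * Real.pi) ^ 2) *
        eLpNorm f 2 volume ^ 2 := by
    rw [mul_pow, ← mul_assoc, ENNReal.ofReal_mul hD,
      ENNReal.ofReal_pow ENNReal.toReal_nonneg, ENNReal.ofReal_toReal hf2]
  rw [← ENNReal.ofReal_sum_sum_toReal_pow_rpow N S
    (x := fun (n : ℤ) α ↦ cubeNorm μ α (halfWave f (τ + n * μ⁻¹ ^ 2)))
    fun n α ↦ cubeNorm_ne_top hμ α (norm_halfWave_le f _), ← hK]
  exact ENNReal.ofReal_le_ofReal (hf.sum_sum_toReal_cubeNorm_le hμ hμ1 τ N S)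

lemma UnitFrequency.sum_tsum_cubeNorm_le {f : SchwartzMap Sp ℂ} (hf : UnitFrequency f)
    {μ : ℝ} (hμ : 0 < μ) (hμ1 : μ ≤ 1) (τ : ℝ) (N : Finset ℤ) :
    ∑ n ∈ N, (∑' α, cubeNorm μ α (halfWave f (τ + n * μ⁻¹ ^ 2)) ^ 6) ^ (1 / 3 : ℝ) ≤
      ENNReal.ofReal (2 ^ 41 * gramConst * Real.exp (2 * Real.pi) ^ 2) *
        eLpNorm f 2 volume ^ 2 := by
  refine le_of_tendsto' (tendsto_finsetSum N fun n _ ↦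
    ((ENNReal.continuous_rpow_const (y := 1 / 3)).tendsto _).comp ENNReal.summable.hasSum)
    fun S ↦ hf.sum_sum_cubeNorm_le hμ hμ1 τ N S

/-- (Two-scale Strichartz estimate.)  For every `r ∈ [6,∞)` there is a
constant `C_r` such that for any unit-frequency Schwartz `f`, any `0 < μ ≤ 1`, and the
partition of `ℝ⁴` into cubes `Q_α` of side `1/μ`, the half-wave evolution
`u(t,x) = e^{it√(−Δ)}f(x)` satisfies
`(∫ (Σ_α ‖u(t,·)‖_{L²(Q_α)}^r)^{2/r} dt)^{1/2} ≤ C_r μ⁻¹ ‖f‖_{L²(ℝ⁴)}`. -/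
theorem statement8 (r : ℝ) (hr : 6 ≤ r) :
    ∃ C : ℝ, 0 < C ∧ ∀ f : SchwartzMap Sp ℂ, UnitFrequency f →
      ∀ μ : ℝ, 0 < μ → μ ≤ 1 →
        (∫⁻ t : ℝ, (∑' a : Fin 4 → ℤ,
            cubeNorm μ a (halfWave f t) ^ r) ^ (2/r)) ^ (1/2 : ℝ) ≤
          ENNReal.ofReal C * ENNReal.ofReal μ⁻¹ * eLpNorm (⇑f) 2 volume := by
  have hg := gramConst_pos
  set D : ℝ := 2 ^ 41 * gramConst * Real.exp (2 * Real.pi) ^ 2 with hD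
  have hD0 : 0 < D := by positivity
  refine ⟨√D, Real.sqrt_pos.2 hD0, fun f hf μ hμ hμ1 ↦ ?_⟩
  have h := lintegral_le_mul_of_sum_translates_le
    (F := fun t ↦ (∑' a : Fin 4 → ℤ, cubeNorm μ a (halfWave f t) ^ r) ^ (2 / r))
    (T := μ⁻¹ ^ 2) (by positivity)
    fun τ N ↦ (Finset.sum_le_sum fun (n : ℤ) _ ↦ ENNReal.tsum_rpow_rpow_le
      (fun a ↦ cubeNorm μ a (halfWave f (τ + n * μ⁻¹ ^ 2))) hr).trans
      (hf.sum_tsum_cubeNorm_le hμ hμ1 τ N)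
  have hsq : ENNReal.ofReal D * eLpNorm f 2 volume ^ 2 * ENNReal.ofReal (μ⁻¹ ^ 2) =
      (ENNReal.ofReal √D * ENNReal.ofReal μ⁻¹ * eLpNorm f 2 volume) ^ 2 := by
    rw [mul_pow, mul_pow, ← ENNReal.ofReal_pow (Real.sqrt_nonneg D), Real.sq_sqrt hD0.le,
      ENNReal.ofReal_pow (by positivity)]
    ring
  refine (ENNReal.rpow_le_rpow (h.trans_eq hsq) (by norm_num)).trans_eq ?_
  rw [← ENNReal.rpow_natCast, ← ENNReal.rpow_mul]
  norm_num

end
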